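/- Lyapunov exponent at t = 0: Let t = 0 (so f ≡ λ₂′ and g(x) = −λ₂ e^{−2πix}), λ₁, λ₂ ∈ (0,1), Φ irrational, θ ∈ ℝ, and let z belong to the spectrum Σ of W = W_{λ₁,λ₂,Φ,θ}. Then the Lyapunov exponent L(Φ, S_z⁺) exists and equals max{ ln( (λ₁′ λ₂)/(λ₁ λ₂′) ), 0 }. -/

import Mathlib

open MeasureTheory

noncomputable section

/-- `λ' = √(1 - λ²)`. -/
def sq1 (l : ℝ) : ℝ := Real.sqrt (1 - l ^ 2)

/-- The sampling function `f(x) = (1/k)(2 t λ₂ cos(2πx) + (t²−1) λ₂′)` with `k = −(1+t²)`. -/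
def fS (t l x : ℝ) : ℝ :=
  (1 / (-(1 + t ^ 2))) * (2 * t * l * Real.cos (2 * Real.pi * x) + (t ^ 2 - 1) * sq1 l)

/-- The sampling function `g(x) = (1/k)(−t² λ₂ e^{2πix} + λ₂ e^{−2πix} + 2 t λ₂′)`. -/
def gS (t l x : ℝ) : ℂ :=
  ((1 / (-(1 + t ^ 2)) : ℝ) : ℂ) *
    (-(((t ^ 2 * l : ℝ)) : ℂ) * Complex.exp (2 * Real.pi * x * Complex.I)
      + ((l : ℝ) : ℂ) * Complex.exp (-(2 * Real.pi * x) * Complex.I)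
      + ((2 * t * sq1 l : ℝ) : ℂ))

/-- The Hilbert space `ℓ²(ℤ; ℂ²)`. -/
abbrev H2 := lp (fun _ : ℤ => EuclideanSpace ℂ (Fin 2)) 2

/-- The `+` component of `W ψ = S_{λ₁} Q ψ` at site `n`. -/
def wPlus (t l1 l2 Φ θ : ℝ) (ψ : ℤ → EuclideanSpace ℂ (Fin 2)) (n : ℤ) : ℂ :=
  (l1 : ℂ) * ((fS t l2 (θ + ((n : ℝ) - 1) * Φ) : ℂ) * ψ (n - 1) 0
      - gS t l2 (θ + ((n : ℝ) - 1) * Φ) * ψ (n - 1) 1)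
    - (sq1 l1 : ℂ) * ((starRingEnd ℂ) (gS t l2 (θ + (n : ℝ) * Φ)) * ψ n 0
      + (fS t l2 (θ + (n : ℝ) * Φ) : ℂ) * ψ n 1)

/-- The `−` component of `W ψ = S_{λ₁} Q ψ` at site `n`. -/
def wMinus (t l1 l2 Φ θ : ℝ) (ψ : ℤ → EuclideanSpace ℂ (Fin 2)) (n : ℤ) : ℂ :=
  (l1 : ℂ) * ((starRingEnd ℂ) (gS t l2 (θ + ((n : ℝ) + 1) * Φ)) * ψ (n + 1) 0
      + (fS t l2 (θ + ((n : ℝ) + 1) * Φ) : ℂ) * ψ (n + 1) 1)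
    + (sq1 l1 : ℂ) * ((fS t l2 (θ + (n : ℝ) * Φ) : ℂ) * ψ n 0
      - gS t l2 (θ + (n : ℝ) * Φ) * ψ n 1)

/-- `ψ` is a (generalized) eigenvector of `W_{λ₁,λ₂,Φ,θ}` with eigenvalue `z`. -/
def IsEigen (t l1 l2 Φ θ : ℝ) (z : ℂ) (ψ : ℤ → EuclideanSpace ℂ (Fin 2)) : Prop :=
  ∀ n : ℤ, wPlus t l1 l2 Φ θ ψ n = z * ψ n 0 ∧ wMinus t l1 l2 Φ θ ψ n = z * ψ n 1


/-- `p(w) = (1/k)(t²λ₂e^{2πiw} − λ₂e^{−2πiw} − 2tλ₂′)`. -/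
def pS (t l2 : ℝ) (w : ℂ) : ℂ :=
  (1 / (-(1 + (t : ℂ) ^ 2))) *
    ((t : ℂ) ^ 2 * (l2 : ℂ) * Complex.exp (2 * Real.pi * Complex.I * w)
      - (l2 : ℂ) * Complex.exp (-(2 * Real.pi * Complex.I * w))
      - 2 * (t : ℂ) * (sq1 l2 : ℂ))

/-- `q(w) = (1/k)(t²λ₂e^{−2πiw} − λ₂e^{2πiw} − 2tλ₂′)`. -/
def qS (t l2 : ℝ) (w : ℂ) : ℂ :=
  (1 / (-(1 + (t : ℂ) ^ 2))) *
    ((t : ℂ) ^ 2 * (l2 : ℂ) * Complex.exp (-(2 * Real.pi * Complex.I * w))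
      - (l2 : ℂ) * Complex.exp (2 * Real.pi * Complex.I * w)
      - 2 * (t : ℂ) * (sq1 l2 : ℂ))

/-- The matrix `D_z(w)`. -/
def Dz (t l1 l2 : ℝ) (z w : ℂ) : Matrix (Fin 2) (Fin 2) ℂ :=
  !![z ^ 2 - (sq1 l1 : ℂ) * z * pS t l2 w, qS t l2 w * z - (sq1 l1 : ℂ);
     -(sq1 l1 : ℂ) * z ^ 2 + pS t l2 w * z, -(sq1 l1 : ℂ) * z * qS t l2 w + 1]

/-- The two-step Szegő cocycle map `S_z⁺(x) = (z⁻¹/(λ₁|f(x)|)) D_z(x)`. -/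
def SzP (t l1 l2 : ℝ) (z : ℂ) (x : ℝ) : Matrix (Fin 2) (Fin 2) ℂ :=
  (z⁻¹ / ((l1 : ℂ) * ((|fS t l2 x| : ℝ) : ℂ))) • Dz t l1 l2 z (x : ℂ)

/-- `n`-step cocycle product `Mⁿ(x) = M(x+(n−1)Φ) ⋯ M(x+Φ) M(x)`. -/
def coc (Φ : ℝ) (M : ℝ → Matrix (Fin 2) (Fin 2) ℂ) : ℕ → ℝ → Matrix (Fin 2) (Fin 2) ℂ
  | 0, _ => 1
  | n + 1, x => M (x + (n : ℝ) * Φ) * coc Φ M n x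

attribute [local instance] Matrix.frobeniusNormedAddCommGroup

/-- The Lyapunov exponent of the cocycle `(Φ, M)` exists and equals `c`. -/
def HasLyap (Φ : ℝ) (M : ℝ → Matrix (Fin 2) (Fin 2) ℂ) (c : ℝ) : Prop :=
  Filter.Tendsto
    (fun n : ℕ => (1 / (n : ℝ)) * ∫ x in (0:ℝ)..1, Real.log ‖coc Φ M n x‖)
    Filter.atTop (nhds c)

attribute [local instance] Matrix.frobeniusNormedSpace

local notation "𝕄" => Matrix (Fin 2) (Fin 2) ℂ

/-- A trigonometric polynomial of degree one, `ζ⁻¹ lo + mid + ζ hi`, with `2 × 2` coefficients. -/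
structure TrigCocycle where
  lo : Matrix (Fin 2) (Fin 2) ℂ
  mid : Matrix (Fin 2) (Fin 2) ℂ
  hi : Matrix (Fin 2) (Fin 2) ℂ

namespace TrigCocycle

/-- The value at `ζ`. -/
def eval (A : TrigCocycle) (ζ : ℂ) : 𝕄 := ζ⁻¹ • A.lo + A.mid + ζ • A.hi

/-- The product `A(ω^(n-1) ζ) ⋯ A(ω ζ) A(ζ)`. -/
def prod (A : TrigCocycle) (ω : ℂ) : ℕ → ℂ → 𝕄
  | 0, _ => 1
  | n + 1, ζ => A.eval (ω ^ n * ζ) * A.prod ω n ζ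

/-- The coefficients of `prod` as a Laurent polynomial in `ζ`. -/
def coeff (A : TrigCocycle) (ω : ℂ) : ℕ → ℤ → 𝕄
  | 0, k => if k = 0 then 1 else 0
  | n + 1, k => (ω ^ n)⁻¹ • (A.lo * A.coeff ω n (k + 1)) + A.mid * A.coeff ω n k
      + ω ^ n • (A.hi * A.coeff ω n (k - 1))

variable (A : TrigCocycle) (ω : ℂ)

lemma coeff_eq_zero (n : ℕ) : ∀ k : ℤ, (n : ℤ) < |k| → A.coeff ω n k = 0 := by
  induction n with
  | zero => intro k hk; simp at hk; simp [coeff, hk]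
  | succ n ih =>
    intro k hk
    push_cast at hk
    have h1 : (n : ℤ) < |k + 1| := by grind
    have h2 : (n : ℤ) < |k - 1| := by grind
    have h3 : (n : ℤ) < |k| := by grind
    simp [coeff, ih _ h1, ih _ h2, ih _ h3]

lemma coeff_support_finite (n : ℕ) (F : ℤ → 𝕄) (hF : ∀ k, A.coeff ω n k = 0 → F k = 0) :
    (Function.support F).Finite := by
  refine (Set.finite_Icc (-(n : ℤ)) n).subset fun k hk => ?_
  by_contra h
  refine hk (hF k (A.coeff_eq_zero ω n k ?_))
  simp only [Set.mem_Icc, not_and_or, not_le] at h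
  grind

lemma prod_eq_finsum {ω : ℂ} (hω : ω ≠ 0) (n : ℕ) {ζ : ℂ} (hζ : ζ ≠ 0) :
    A.prod ω n ζ = ∑ᶠ k : ℤ, ζ ^ k • A.coeff ω n k := by
  induction n with
  | zero =>
    rw [finsum_eq_single _ 0]
    · simp [prod, coeff]
    · intro k hk; simp [coeff, hk]
  | succ n ih =>
    have e1 : ∑ᶠ k : ℤ, ζ ^ k • ((ω ^ n)⁻¹ • (A.lo * A.coeff ω n (k + 1)))
        = (ω ^ n * ζ)⁻¹ • (A.lo * A.prod ω n ζ) := by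
      rw [ih, mul_finsum' _ _ (A.coeff_support_finite ω n _ fun k hk => by simp [hk]), smul_finsum,
        ← finsum_comp_equiv (Equiv.addRight (-1 : ℤ))]
      refine finsum_congr fun k => ?_
      simp only [Equiv.coe_addRight, Matrix.mul_smul, smul_smul, mul_inv, neg_add_cancel_right]
      rw [zpow_add₀ hζ]; congr 1; field_simp
    have e2 : ∑ᶠ k : ℤ, ζ ^ k • (ω ^ n • (A.hi * A.coeff ω n (k - 1)))
        = (ω ^ n * ζ) • (A.hi * A.prod ω n ζ) := by
      rw [ih, mul_finsum' _ _ (A.coeff_support_finite ω n _ fun k hk => by simp [hk]), smul_finsum,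
        ← finsum_comp_equiv (Equiv.addRight (1 : ℤ))]
      refine finsum_congr fun k => ?_
      simp only [Equiv.coe_addRight, Matrix.mul_smul, smul_smul, add_sub_cancel_right]
      rw [zpow_add₀ hζ]; congr 1; field_simp
    have e3 : ∑ᶠ k : ℤ, ζ ^ k • (A.mid * A.coeff ω n k) = A.mid * A.prod ω n ζ := by
      rw [ih, mul_finsum' _ _ (A.coeff_support_finite ω n _ fun k hk => by simp [hk])]
      refine finsum_congr fun k => ?_
      simp
    have f1 : (Function.support fun k : ℤ =>
        ζ ^ k • ((ω ^ n)⁻¹ • (A.lo * A.coeff ω n (k + 1)))).Finite := by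
      have := A.coeff_support_finite ω n (fun k : ℤ => A.coeff ω n k) (fun k hk => hk)
      refine ((this.image fun k => k - 1)).subset fun k hk => ⟨k + 1, ?_, by simp⟩
      intro h
      exact hk (by simp only [h]; simp)
    have f2 : (Function.support fun k : ℤ =>
        ζ ^ k • (ω ^ n • (A.hi * A.coeff ω n (k - 1)))).Finite := by
      have := A.coeff_support_finite ω n (fun k : ℤ => A.coeff ω n k) (fun k hk => hk)
      refine ((this.image fun k => k + 1)).subset fun k hk => ⟨k - 1, ?_, by simp⟩
      intro h
      exact hk (by simp only [h]; simp)
    have f3 : (Function.support fun k : ℤ => ζ ^ k • (A.mid * A.coeff ω n k)).Finite :=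
      A.coeff_support_finite ω n _ fun k hk => by simp [hk]
    have : ∀ k : ℤ, ζ ^ k • A.coeff ω (n + 1) k =
        (ζ ^ k • ((ω ^ n)⁻¹ • (A.lo * A.coeff ω n (k + 1)))
          + ζ ^ k • (A.mid * A.coeff ω n k))
          + ζ ^ k • (ω ^ n • (A.hi * A.coeff ω n (k - 1))) := by
      intro k; simp only [coeff, smul_add]
    rw [finsum_congr this, finsum_add_distrib _ f2, finsum_add_distrib f1 f3, e1, e2, e3]
    · simp [prod, eval, add_mul]
    · exact (f1.union f3).subset (Function.support_add _ _)

lemma prod_eq_sum {ω : ℂ} (hω : ω ≠ 0) (n : ℕ) {ζ : ℂ} (hζ : ζ ≠ 0) :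
    A.prod ω n ζ = ∑ k ∈ Finset.Icc (-(n : ℤ)) n, ζ ^ k • A.coeff ω n k := by
  rw [A.prod_eq_finsum hω n hζ]
  refine finsum_eq_sum_of_support_subset _ fun k hk => ?_
  by_contra h
  simp only [Finset.coe_Icc, Set.mem_Icc, not_and_or, not_le] at h
  have h0 : A.coeff ω n k = 0 := A.coeff_eq_zero ω n k (by grind)
  exact hk (by simp [h0])

lemma coeff_self (n : ℕ) :
    A.coeff ω n n = (∏ j ∈ Finset.range n, ω ^ j) • A.hi ^ n := by
  induction n with
  | zero => simp [coeff]
  | succ n ih =>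
    have h1 := A.coeff_eq_zero ω n ((n : ℤ) + 1 + 1) (by grind)
    have h2 := A.coeff_eq_zero ω n ((n : ℤ) + 1) (by grind)
    simp [coeff, h1, h2, ih, Finset.prod_range_succ, pow_succ', smul_smul, mul_comm]

lemma coeff_neg_self (n : ℕ) :
    A.coeff ω n (-n) = (∏ j ∈ Finset.range n, (ω ^ j)⁻¹) • A.lo ^ n := by
  induction n with
  | zero => simp [coeff]
  | succ n ih =>
    have h1 := A.coeff_eq_zero ω n (-((n : ℤ) + 1) - 1) (by grind)
    have h2 := A.coeff_eq_zero ω n (-((n : ℤ) + 1)) (by grind)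
    have h3 : -((n : ℤ) + 1) + 1 = -n := by ring
    simp only [coeff, Nat.cast_succ, h1, h2, h3, ih, Finset.prod_range_succ, pow_succ']
    simp [smul_smul, mul_comm]

lemma prod_add (m n : ℕ) (ζ : ℂ) :
    A.prod ω (m + n) ζ = A.prod ω m (ω ^ n * ζ) * A.prod ω n ζ := by
  induction m with
  | zero => simp [prod]
  | succ m ih =>
    rw [Nat.succ_add]
    simp only [prod, ih, pow_add, mul_assoc]

lemma det_prod {ω : ℂ} (hω : ω ≠ 0) (hA : ∀ ζ ≠ 0, (A.eval ζ).det = 1) (n : ℕ) {ζ : ℂ}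
    (hζ : ζ ≠ 0) : (A.prod ω n ζ).det = 1 := by
  induction n with
  | zero => simp [prod]
  | succ n ih =>
    simp only [prod, Matrix.det_mul, ih, mul_one]
    exact hA _ (mul_ne_zero (pow_ne_zero _ hω) hζ)

end TrigCocycle

lemma norm_sq_eq (M : 𝕄) : ‖M‖ ^ 2 = ‖M 0 0‖ ^ 2 + ‖M 0 1‖ ^ 2 + ‖M 1 0‖ ^ 2 + ‖M 1 1‖ ^ 2 := by
  rw [Matrix.frobenius_norm_def, ← Real.rpow_natCast, ← Real.rpow_mul]
  · simp [Fin.sum_univ_two]; ring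
  · positivity

lemma norm_entry_le (M : 𝕄) (i j : Fin 2) : ‖M i j‖ ≤ ‖M‖ := by
  refine le_of_sq_le_sq ?_ (norm_nonneg _)
  rw [norm_sq_eq]
  have h := fun i j : Fin 2 => sq_nonneg ‖M i j‖
  fin_cases i <;> fin_cases j <;> simp only [Fin.mk_zero, Fin.mk_one, Fin.isValue] <;>
    linarith [h 0 0, h 0 1, h 1 0, h 1 1]

lemma norm_adjugate (M : 𝕄) : ‖M.adjugate‖ = ‖M‖ := by
  rw [← sq_eq_sq₀ (norm_nonneg _) (norm_nonneg _), norm_sq_eq, norm_sq_eq, Matrix.adjugate_fin_two]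
  simp; ring

lemma one_le_norm_of_det {M : 𝕄} (h : M.det = 1) : 1 ≤ ‖M‖ := by
  rw [Matrix.det_fin_two] at h
  have h1 : (1 : ℝ) ≤ ‖M 0 0‖ * ‖M 1 1‖ + ‖M 0 1‖ * ‖M 1 0‖ := by
    rw [← norm_mul, ← norm_mul, ← norm_one (α := ℂ), ← h]; exact norm_sub_le _ _
  have h2 := norm_sq_eq M
  nlinarith [sq_nonneg (‖M 0 0‖ - ‖M 1 1‖), sq_nonneg (‖M 0 1‖ - ‖M 1 0‖), norm_nonneg M]

lemma norm_trace_le (M : 𝕄) : ‖M.trace‖ ≤ 2 * ‖M‖ := by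
  rw [Matrix.trace_fin_two]
  have := norm_add_le (M 0 0) (M 1 1)
  linarith [norm_entry_le M 0 0, norm_entry_le M 1 1]

lemma exp_int_cast_mul (k : ℤ) (s : ℝ) : Real.exp (k * s) = Real.exp s ^ k := by
  rw [mul_comm, Real.exp_mul, Real.rpow_intCast]

/-- Cauchy's estimate for the coefficients of a Laurent polynomial. -/
lemma norm_coeff_le_of_norm_sum_le {E : Type*} [NormedAddCommGroup E] [NormedSpace ℂ E]
    (X : ℤ → E) (N : ℕ) {ρ G : ℝ} (hρ : 0 < ρ)
    (h : ∀ ζ : ℂ, ‖ζ‖ = ρ → ‖∑ k ∈ Finset.Icc (-(N : ℤ)) N, ζ ^ k • X k‖ ≤ G)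
    {k : ℤ} (hk : k ∈ Finset.Icc (-(N : ℤ)) N) : ρ ^ k * ‖X k‖ ≤ G := by
  set M : ℕ := 2 * N + 1 with hM
  have hM0 : M ≠ 0 := by omega
  set η : ℂ := Complex.exp (2 * Real.pi * Complex.I / M) with hη
  have hp : IsPrimitiveRoot η M := Complex.isPrimitiveRoot_exp M hM0
  have hη0 : η ≠ 0 := Complex.exp_ne_zero _
  have hη1 : ‖η‖ = 1 := hp.norm'_eq_one hM0
  have hρ0 : (ρ : ℂ) ≠ 0 := by exact_mod_cast hρ.ne'
  have key : ∑ j ∈ Finset.range M, ((ρ * η ^ j : ℂ) ^ k)⁻¹ •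
      ∑ l ∈ Finset.Icc (-(N : ℤ)) N, (ρ * η ^ j : ℂ) ^ l • X l = (M : ℂ) • X k := by
    simp only [Finset.smul_sum, smul_smul]
    rw [Finset.sum_comm, Finset.sum_eq_single k]
    · have : ∀ j ∈ Finset.range M, (((ρ * η ^ j : ℂ) ^ k)⁻¹ * (ρ * η ^ j : ℂ) ^ k) • X k = X k := by
        intro j _
        rw [inv_mul_cancel₀ (zpow_ne_zero _ (mul_ne_zero hρ0 (pow_ne_zero _ hη0))), one_smul]
      rw [Finset.sum_congr rfl this]
      simp [← Nat.cast_smul_eq_nsmul ℂ]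
    · intro l hl hlk
      rw [← Finset.sum_smul]
      have e : ∀ j ∈ Finset.range M, ((ρ * η ^ j : ℂ) ^ k)⁻¹ * (ρ * η ^ j : ℂ) ^ l
          = (ρ : ℂ) ^ (l - k) * (η ^ (l - k)) ^ j := by
        intro j _
        rw [← zpow_neg, ← zpow_add₀ (mul_ne_zero hρ0 (pow_ne_zero _ hη0)), mul_zpow,
          show -k + l = l - k by ring, ← zpow_natCast, ← zpow_natCast, ← zpow_mul, ← zpow_mul,
          mul_comm (j : ℤ)]
      rw [Finset.sum_congr rfl e, ← Finset.mul_sum]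
      have h1 : η ^ (l - k) ≠ 1 := by
        rw [Ne, hp.zpow_eq_one_iff_dvd]
        intro hd
        have := Int.le_of_dvd (abs_pos.2 (sub_ne_zero.2 hlk)) ((dvd_abs _ _).2 hd)
        simp only [Finset.mem_Icc] at hl hk
        grind
      have h2 : ∑ j ∈ Finset.range M, (η ^ (l - k)) ^ j = 0 := by
        have := mul_neg_geom_sum (η ^ (l - k)) M
        rw [← zpow_natCast, ← zpow_mul, mul_comm (l - k), zpow_mul, zpow_natCast,
          hp.pow_eq_one, one_zpow, sub_self] at this
        exact (mul_eq_zero.1 this).resolve_left (sub_ne_zero.2 h1.symm)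
      rw [h2, mul_zero, zero_smul]
    · intro h; exact absurd hk h
  have hb : ‖(M : ℂ) • X k‖ ≤ M * ((ρ ^ k)⁻¹ * G) := by
    rw [← key]
    refine (norm_sum_le_of_le _ (fun j _ => ?_)).trans_eq (b := ∑ j ∈ Finset.range M, (ρ ^ k)⁻¹ * G)
      (by simp)
    have hn : ‖(ρ * η ^ j : ℂ)‖ = ρ := by simp [hη1, abs_of_pos hρ]
    rw [norm_smul, norm_inv, norm_zpow, hn]
    exact mul_le_mul_of_nonneg_left (h _ hn) (by positivity)
  rw [norm_smul, Complex.norm_natCast] at hb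
  have h3 := le_of_mul_le_mul_left hb (by positivity)
  rwa [← div_eq_inv_mul, le_div_iff₀ (by positivity), mul_comm] at h3

namespace TrigCocycle
variable (A : TrigCocycle)

/-- The maximum of the norm of the `n`-step product on the circle of radius `exp s`. -/
def growth (ω : ℂ) (n : ℕ) (s : ℝ) : ℝ :=
  sSup ((fun ζ => ‖A.prod ω n ζ‖) '' Metric.sphere (0 : ℂ) (Real.exp s))

/-- The exponential growth rate of the cocycle on the circle of radius `exp s`. -/
def rate (ω : ℂ) (s : ℝ) : ℝ :=
  sInf ((fun n : ℕ => Real.log (A.growth ω n s) / n) '' Set.Ici 1)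

lemma norm_eval_le {ζ : ℂ} {s : ℝ} (hζ : ‖ζ‖ = Real.exp s) :
    ‖A.eval ζ‖ ≤ (Real.exp s)⁻¹ * ‖A.lo‖ + ‖A.mid‖ + Real.exp s * ‖A.hi‖ := by
  refine (norm_add₃_le).trans_eq ?_
  rw [norm_smul, norm_smul, norm_inv, hζ]

lemma ne_zero_of_norm {ζ : ℂ} {s : ℝ} (hζ : ‖ζ‖ = Real.exp s) : ζ ≠ 0 := by
  rw [← norm_pos_iff, hζ]; positivity

variable {A} {ω : ℂ}

lemma norm_pow_mul (hω : ‖ω‖ = 1) (n : ℕ) (ζ : ℂ) : ‖ω ^ n * ζ‖ = ‖ζ‖ := by simp [hω]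

lemma bddAbove_growth (hω : ‖ω‖ = 1) (n : ℕ) (s : ℝ) :
    BddAbove ((fun ζ => ‖A.prod ω n ζ‖) '' Metric.sphere (0 : ℂ) (Real.exp s)) := by
  induction n with
  | zero => exact ⟨‖(1 : 𝕄)‖, by rintro _ ⟨ζ, _, rfl⟩; exact le_rfl⟩
  | succ n ih =>
    obtain ⟨b, hb⟩ := ih
    refine ⟨((Real.exp s)⁻¹ * ‖A.lo‖ + ‖A.mid‖ + Real.exp s * ‖A.hi‖) * b, ?_⟩
    rintro _ ⟨ζ, hζ, rfl⟩
    have h1 := hb ⟨ζ, hζ, rfl⟩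
    rw [mem_sphere_zero_iff_norm] at hζ
    refine (Matrix.frobenius_norm_mul _ _).trans ?_
    exact mul_le_mul (A.norm_eval_le (by rw [norm_pow_mul hω, hζ])) h1 (norm_nonneg _)
      (by positivity)

lemma norm_prod_le_growth (hω : ‖ω‖ = 1) (n : ℕ) {s : ℝ} {ζ : ℂ} (hζ : ‖ζ‖ = Real.exp s) :
    ‖A.prod ω n ζ‖ ≤ A.growth ω n s :=
  le_csSup (bddAbove_growth hω n s) ⟨ζ, by simpa using hζ, rfl⟩

lemma growth_le (n : ℕ) {s b : ℝ} (h : ∀ ζ : ℂ, ‖ζ‖ = Real.exp s → ‖A.prod ω n ζ‖ ≤ b) :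
    A.growth ω n s ≤ b := by
  refine csSup_le ?_ ?_
  · exact ⟨_, (Real.exp s : ℂ), by simp, rfl⟩
  · rintro _ ⟨ζ, hζ, rfl⟩; exact h ζ (by simpa using hζ)

lemma one_le_growth (hω : ‖ω‖ = 1) (hA : ∀ ζ ≠ 0, (A.eval ζ).det = 1) (n : ℕ) (s : ℝ) :
    1 ≤ A.growth ω n s := by
  have hs : ‖((Real.exp s : ℝ) : ℂ)‖ = Real.exp s := by simp
  refine le_trans (one_le_norm_of_det ?_) (norm_prod_le_growth hω n hs)
  exact A.det_prod (by rintro rfl; simp at hω) hA n (ne_zero_of_norm hs)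

lemma growth_add_le (hω : ‖ω‖ = 1) (m n : ℕ) (s : ℝ) :
    A.growth ω (m + n) s ≤ A.growth ω m s * A.growth ω n s := by
  refine growth_le _ fun ζ hζ => ?_
  rw [prod_add]
  refine (Matrix.frobenius_norm_mul _ _).trans ?_
  have h1 := norm_prod_le_growth (A := A) hω m (ζ := ω ^ n * ζ) (by rw [norm_pow_mul hω, hζ])
  exact mul_le_mul h1 (norm_prod_le_growth hω n hζ) (norm_nonneg _) ((norm_nonneg _).trans h1)

lemma subadditive_log_growth (hω : ‖ω‖ = 1) (hA : ∀ ζ ≠ 0, (A.eval ζ).det = 1) (s : ℝ) :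
    Subadditive fun n => Real.log (A.growth ω n s) := by
  intro m n
  have h1 := one_le_growth hω hA m s
  have h2 := one_le_growth hω hA n s
  rw [← Real.log_mul (by positivity) (by positivity)]
  exact Real.log_le_log (by linarith [one_le_growth hω hA (m + n) s]) (growth_add_le hω m n s)

lemma bddBelow_log_growth (hω : ‖ω‖ = 1) (hA : ∀ ζ ≠ 0, (A.eval ζ).det = 1) (s : ℝ) :
    BddBelow (Set.range fun n : ℕ => Real.log (A.growth ω n s) / n) := by
  refine ⟨0, ?_⟩
  rintro _ ⟨n, rfl⟩
  exact div_nonneg (Real.log_nonneg (one_le_growth hω hA n s)) n.cast_nonneg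

lemma lim_log_growth (hω : ‖ω‖ = 1) (hA : ∀ ζ ≠ 0, (A.eval ζ).det = 1) (s : ℝ) :
    (subadditive_log_growth hω hA s).lim = A.rate ω s := by
  rw [Subadditive.lim, rate]

lemma tendsto_rate (hω : ‖ω‖ = 1) (hA : ∀ ζ ≠ 0, (A.eval ζ).det = 1) (s : ℝ) :
    Filter.Tendsto (fun n : ℕ => Real.log (A.growth ω n s) / n) Filter.atTop
      (nhds (A.rate ω s)) :=
  lim_log_growth hω hA s ▸ (subadditive_log_growth hω hA s).tendsto_lim (bddBelow_log_growth hω hA s)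

lemma rate_le (hω : ‖ω‖ = 1) (hA : ∀ ζ ≠ 0, (A.eval ζ).det = 1) (s : ℝ) {n : ℕ} (hn : n ≠ 0) :
    A.rate ω s ≤ Real.log (A.growth ω n s) / n :=
  lim_log_growth hω hA s ▸ (subadditive_log_growth hω hA s).lim_le_div (bddBelow_log_growth hω hA s) hn

lemma exp_rate_le_growth (hω : ‖ω‖ = 1) (hA : ∀ ζ ≠ 0, (A.eval ζ).det = 1) (s : ℝ) (n : ℕ) :
    Real.exp (n * A.rate ω s) ≤ A.growth ω n s := by
  have h1 := one_le_growth hω hA n s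
  rw [← Real.le_log_iff_exp_le (by linarith)]
  rcases Nat.eq_zero_or_pos n with rfl | hn
  · simpa using Real.log_nonneg h1
  · have := rate_le hω hA s hn.ne'
    rw [le_div_iff₀ (by positivity)] at this
    linarith

lemma rate_nonneg (hω : ‖ω‖ = 1) (hA : ∀ ζ ≠ 0, (A.eval ζ).det = 1) (s : ℝ) :
    0 ≤ A.rate ω s :=
  ge_of_tendsto' (tendsto_rate hω hA s) fun n =>
    div_nonneg (Real.log_nonneg (one_le_growth hω hA n s)) n.cast_nonneg

lemma eventually_growth_le (hω : ‖ω‖ = 1) (hA : ∀ ζ ≠ 0, (A.eval ζ).det = 1) (s : ℝ) {c : ℝ}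
    (hc : A.rate ω s < c) :
    ∀ᶠ n : ℕ in Filter.atTop, A.growth ω n s ≤ Real.exp (n * c) := by
  filter_upwards [(tendsto_rate hω hA s).eventually_lt_const hc, Filter.eventually_gt_atTop 0]
    with n hn hn0
  have h1 := one_le_growth hω hA n s
  rw [div_lt_iff₀ (by positivity)] at hn
  rw [← Real.log_le_iff_le_exp (by linarith)]
  linarith

lemma exp_mul_norm_coeff_le (hω : ‖ω‖ = 1) (n : ℕ) (k : ℤ) (s : ℝ) :
    Real.exp (k * s) * ‖A.coeff ω n k‖ ≤ A.growth ω n s := by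
  by_cases hk : k ∈ Finset.Icc (-(n : ℤ)) n
  · have := norm_coeff_le_of_norm_sum_le (A.coeff ω n) n (Real.exp_pos s)
      (G := A.growth ω n s) (fun ζ hζ => ?_) hk
    · rwa [← exp_int_cast_mul] at this
    · rw [← A.prod_eq_sum (by rintro rfl; simp at hω) n (ne_zero_of_norm hζ)]
      exact norm_prod_le_growth hω n hζ
  · rw [A.coeff_eq_zero ω n k, norm_zero, mul_zero]
    · have hs : ‖((Real.exp s : ℝ) : ℂ)‖ = Real.exp s := by simp
      exact (norm_nonneg _).trans (norm_prod_le_growth hω n hs)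
    · simp only [Finset.mem_Icc, not_and_or, not_le] at hk
      grind

lemma growth_le_of_coeff (hω : ‖ω‖ = 1) (n : ℕ) {s b : ℝ}
    (h : ∀ k : ℤ, |k| ≤ n → Real.exp (k * s) * ‖A.coeff ω n k‖ ≤ b) :
    A.growth ω n s ≤ (2 * n + 1) * b := by
  refine growth_le _ fun ζ hζ => ?_
  rw [A.prod_eq_sum (by rintro rfl; simp at hω) n (ne_zero_of_norm hζ)]
  refine (norm_sum_le_of_le (f := fun k : ℤ => ζ ^ k • A.coeff ω n k) (n := fun _ => b) _
    (fun k hk => ?_)).trans_eq ?_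
  · rw [norm_smul, norm_zpow, hζ, ← exp_int_cast_mul]
    exact h k (by simp only [Finset.mem_Icc] at hk; grind)
  · rw [Finset.sum_const, Int.card_Icc, nsmul_eq_mul]
    congr 1
    rw [show ((n : ℤ) + 1 - -(n : ℤ)).toNat = 2 * n + 1 by omega]
    push_cast; ring

lemma growth_shift_le (hω : ‖ω‖ = 1) (n : ℕ) (s h : ℝ) :
    A.growth ω n (s + h) ≤ (2 * n + 1) * (Real.exp (n * |h|) * A.growth ω n s) := by
  refine growth_le_of_coeff hω n fun k hk => ?_
  have h1 := exp_mul_norm_coeff_le (A := A) hω n k s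
  have h2 : (k : ℝ) * h ≤ n * |h| := by
    refine (le_abs_self _).trans ?_
    rw [abs_mul]
    have : |(k : ℝ)| ≤ n := by exact_mod_cast hk
    gcongr
  rw [mul_add, Real.exp_add, mul_comm (Real.exp _), mul_assoc]
  exact mul_le_mul (Real.exp_le_exp.2 h2) h1 (by positivity) (by positivity)

lemma growth_sq_le (hω : ‖ω‖ = 1) (n : ℕ) (s h : ℝ) :
    A.growth ω n s ≤ (2 * n + 1) * √(A.growth ω n (s + h) * A.growth ω n (s - h)) := by
  refine growth_le_of_coeff hω n fun k hk => Real.le_sqrt_of_sq_le ?_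
  have h1 := exp_mul_norm_coeff_le (A := A) hω n k (s + h)
  have h2 := exp_mul_norm_coeff_le (A := A) hω n k (s - h)
  refine le_trans (le_of_eq ?_) (mul_le_mul h1 h2 (by positivity) ((by positivity : (0:ℝ) ≤ _).trans h1))
  rw [mul_mul_mul_comm, ← Real.exp_add, mul_pow, ← Real.exp_nat_mul]
  push_cast; ring_nf

lemma tendsto_log_two_mul_add_one_div :
    Filter.Tendsto (fun n : ℕ => Real.log (2 * n + 1) / n) Filter.atTop (nhds 0) := by
  have h : Filter.Tendsto (fun n : ℕ => (2 * n + 1 : ℝ)) Filter.atTop Filter.atTop :=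
    Filter.tendsto_atTop_add_const_right _ _
      (tendsto_natCast_atTop_atTop.const_mul_atTop (by norm_num))
  have h1 := (Real.tendsto_pow_log_div_mul_add_atTop (1/2) (-1/2) 1 (by norm_num)).comp h
  refine h1.congr fun n => ?_
  simp only [Function.comp, pow_one]
  congr 1; ring

lemma rate_add_le (hω : ‖ω‖ = 1) (hA : ∀ ζ ≠ 0, (A.eval ζ).det = 1) (s h : ℝ) :
    A.rate ω (s + h) ≤ |h| + A.rate ω s := by
  have := (tendsto_log_two_mul_add_one_div.add_const |h|).add (tendsto_rate hω hA s)
  rw [zero_add] at this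
  refine le_of_tendsto_of_tendsto (tendsto_rate hω hA (s + h)) this ?_
  filter_upwards [Filter.eventually_gt_atTop 0] with n hn
  have h1 := one_le_growth hω hA n s
  have h2 := one_le_growth hω hA n (s + h)
  have h3 := Real.log_le_log (by linarith) (growth_shift_le (A := A) hω n s h)
  rw [Real.log_mul (by positivity) (by positivity), Real.log_mul (by positivity) (by positivity),
    Real.log_exp] at h3
  have hn' : (0 : ℝ) < n := by positivity
  rw [div_add' _ _ _ hn'.ne', ← add_div]
  gcongr
  linarith

lemma lipschitz_rate (hω : ‖ω‖ = 1) (hA : ∀ ζ ≠ 0, (A.eval ζ).det = 1) :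
    LipschitzWith 1 (A.rate ω) := by
  refine LipschitzWith.of_le_add fun s u => ?_
  have := rate_add_le hω hA u (s - u)
  rw [add_sub_cancel] at this
  rw [Real.dist_eq]; linarith

lemma two_mul_rate_le (hω : ‖ω‖ = 1) (hA : ∀ ζ ≠ 0, (A.eval ζ).det = 1) (s h : ℝ) :
    2 * A.rate ω s ≤ A.rate ω (s + h) + A.rate ω (s - h) := by
  have := ((tendsto_log_two_mul_add_one_div.const_mul 2).add (tendsto_rate hω hA (s + h))).add
    (tendsto_rate hω hA (s - h))
  rw [mul_zero, zero_add] at this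
  refine le_of_tendsto_of_tendsto ((tendsto_rate hω hA s).const_mul 2) this ?_
  filter_upwards with n
  have h1 := one_le_growth hω hA n (s + h)
  have h2 := one_le_growth hω hA n (s - h)
  have h0 := one_le_growth hω hA n s
  have h3 := Real.log_le_log (by linarith) (growth_sq_le (A := A) hω n s h)
  rw [Real.log_mul (by positivity) (by positivity), Real.log_sqrt (by positivity),
    Real.log_mul (by positivity) (by positivity)] at h3
  rw [← mul_div_assoc, ← mul_div_assoc, ← add_div, ← add_div]
  gcongr
  linarith

end TrigCocycle

section Sampling

variable {E : Type*} [NormedAddCommGroup E] [NormedSpace ℂ E]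

lemma differentiable_sum_pow_smul (d : ℕ) (X : ℕ → E) :
    Differentiable ℂ fun ζ : ℂ => ∑ l ∈ Finset.range (d + 1), ζ ^ l • X l := by
  fun_prop

lemma norm_sum_pow_smul_le_of_le (d : ℕ) (X : ℕ → E) {ρ G : ℝ} (hρ : 0 < ρ)
    (h : ∀ ζ : ℂ, ‖ζ‖ = ρ → ‖∑ l ∈ Finset.range (d + 1), ζ ^ l • X l‖ ≤ G)
    {ζ : ℂ} (hζ : ‖ζ‖ ≤ ρ) : ‖∑ l ∈ Finset.range (d + 1), ζ ^ l • X l‖ ≤ G := by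
  refine Complex.norm_le_of_forall_mem_frontier_norm_le (U := Metric.ball (0 : ℂ) ρ)
    Metric.isBounded_ball (differentiable_sum_pow_smul d X).diffContOnCl ?_ ?_
  · intro w hw
    rw [frontier_ball _ hρ.ne', mem_sphere_zero_iff_norm] at hw
    exact h w hw
  · rw [closure_ball _ hρ.ne']; simpa using hζ

lemma norm_sum_pow_smul_le_of_ge (d : ℕ) (X : ℕ → E) {ρ G : ℝ} (hρ : 0 < ρ)
    (h : ∀ ζ : ℂ, ‖ζ‖ = ρ → ‖∑ l ∈ Finset.range (d + 1), ζ ^ l • X l‖ ≤ G)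
    {ζ : ℂ} (hζ : ρ ≤ ‖ζ‖) :
    ‖∑ l ∈ Finset.range (d + 1), ζ ^ l • X l‖ ≤ (‖ζ‖ / ρ) ^ d * G := by
  have key : ∀ w : ℂ, w ≠ 0 → ∑ l ∈ Finset.range (d + 1), w ^ l • X l
      = w ^ d • ∑ l ∈ Finset.range (d + 1), w⁻¹ ^ l • X (d - l) := by
    intro w hw
    rw [← Finset.sum_range_reflect, Finset.smul_sum]
    refine Finset.sum_congr rfl fun l hl => ?_
    have hl' : l ≤ d := by simpa [Nat.lt_succ_iff] using hl
    rw [smul_smul, show d + 1 - 1 - l = d - l by omega]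
    congr 1
    rw [pow_sub₀ _ hw hl', inv_pow]
  have h0 : ζ ≠ 0 := by rw [← norm_pos_iff]; linarith
  rw [key ζ h0, norm_smul, norm_pow, div_pow, div_mul_eq_mul_div, mul_div_assoc]
  gcongr
  refine norm_sum_pow_smul_le_of_le d (fun l => X (d - l)) (inv_pos.2 hρ) (fun w hw => ?_) ?_
  · have hw0 : w ≠ 0 := by rw [← norm_pos_iff, hw]; positivity
    have h1 := h w⁻¹ (by rw [norm_inv, hw, inv_inv])
    rw [key _ (inv_ne_zero hw0), inv_inv, norm_smul, norm_pow, norm_inv, hw, inv_inv] at h1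
    rw [le_div_iff₀ (by positivity)]; linarith
  · rw [norm_inv]; exact inv_anti₀ hρ hζ

/-- A Bernstein-type inequality on a circle, with constant `3`. -/
lemma norm_sum_pow_smul_sub_le (d : ℕ) (X : ℕ → E) {ρ G : ℝ} (hρ : 0 < ρ)
    (h : ∀ ζ : ℂ, ‖ζ‖ = ρ → ‖∑ l ∈ Finset.range (d + 1), ζ ^ l • X l‖ ≤ G)
    {ζ₁ ζ₂ : ℂ} (h₁ : ‖ζ₁‖ = ρ) (h₂ : ‖ζ₂‖ = ρ) :
    ‖∑ l ∈ Finset.range (d + 1), ζ₁ ^ l • X l - ∑ l ∈ Finset.range (d + 1), ζ₂ ^ l • X l‖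
      ≤ 3 * G * (d + 1) / ρ * ‖ζ₁ - ζ₂‖ := by
  have hG : 0 ≤ G := (norm_nonneg _).trans (h ζ₁ h₁)
  set P : ℂ → E := fun ζ => ∑ l ∈ Finset.range (d + 1), ζ ^ l • X l
  have hP : Differentiable ℂ P := differentiable_sum_pow_smul d X
  have hr : 0 < ρ / (d + 1) := by positivity
  have he : (1 + 1 / (d + 1 : ℝ)) ^ d ≤ 3 := by
    have h1 : (1 + 1 / (d + 1 : ℝ)) ^ d ≤ Real.exp (1 / (d + 1)) ^ d := by
      gcongr; rw [add_comm]; exact Real.add_one_le_exp _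
    have h2 : Real.exp (1 / (d + 1 : ℝ)) ^ d ≤ Real.exp 1 := by
      rw [← Real.exp_nat_mul]
      apply Real.exp_le_exp.2
      rw [mul_one_div, div_le_one (by positivity)]; linarith
    linarith [Real.exp_one_lt_d9]
  have hbd : ∀ w : ℂ, ‖w‖ ≤ ρ + ρ / (d + 1) → ‖P w‖ ≤ 3 * G := by
    intro w hw
    rcases le_total ‖w‖ ρ with hw' | hw'
    · linarith [norm_sum_pow_smul_le_of_le d X hρ h hw']
    · refine (norm_sum_pow_smul_le_of_ge d X hρ h hw').trans ?_
      gcongr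
      refine le_trans ?_ he
      gcongr
      rw [div_le_iff₀ hρ]
      calc _ ≤ _ := hw
        _ = _ := by ring
  have hderiv : ∀ w ∈ Metric.closedBall (0 : ℂ) ρ, ‖deriv P w‖ ≤ 3 * G * (d + 1) / ρ := by
    intro w hw
    rw [mem_closedBall_zero_iff] at hw
    have := Complex.norm_deriv_le_of_forall_mem_sphere_norm_le (f := P) (c := w) (C := 3 * G) hr
      hP.diffContOnCl (fun v hv => hbd v ?_)
    · rwa [div_div_eq_mul_div] at this
    · rw [mem_sphere_iff_norm] at hv
      have := norm_add_le (v - w) w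
      rw [sub_add_cancel] at this; linarith
  exact (convex_closedBall (0 : ℂ) ρ).norm_image_sub_le_of_norm_deriv_le
    (fun w _ => hP w) hderiv (by simp [h₂]) (by simp [h₁])

/-- The frequency `exp (2πiΦ)`. -/
def freq (Φ : ℝ) : ℂ := Complex.exp (2 * Real.pi * Φ * Complex.I)

lemma norm_freq (Φ : ℝ) : ‖freq Φ‖ = 1 := by
  have := Complex.norm_exp_ofReal_mul_I (2 * Real.pi * Φ)
  rwa [show (((2 * Real.pi * Φ : ℝ) : ℂ)) = 2 * Real.pi * Φ by push_cast; ring] at this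

lemma norm_freq_sub_freq_le (x y : ℝ) (n : ℤ) :
    ‖freq x - freq y‖ ≤ 2 * Real.pi * |x - y - n| := by
  have h1 : freq x - freq y = freq y * (Complex.exp (Complex.I * (2 * Real.pi * (x - y - n) : ℝ)) - 1) := by
    rw [mul_sub, mul_one, freq, freq, ← Complex.exp_add]
    congr 1
    rw [Complex.exp_eq_exp_iff_exists_int]
    exact ⟨n, by push_cast; ring⟩
  rw [h1, norm_mul, norm_freq, one_mul]
  refine (Real.norm_exp_I_mul_ofReal_sub_one_le).trans_eq ?_
  rw [Real.norm_eq_abs, abs_mul, abs_of_pos (by positivity)]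

lemma freq_pow (Φ : ℝ) (n : ℕ) : freq Φ ^ n = freq (n * Φ) := by
  rw [freq, freq, ← Complex.exp_nat_mul]; congr 1; push_cast; ring

lemma exists_freq_near {Φ : ℝ} {r : ℚ} (hr : |Φ - r| < 1 / (r.den : ℝ) ^ 2) (y : ℝ) :
    ∃ j < r.den, ‖freq Φ ^ j - freq y‖ ≤ 10 / r.den := by
  have hq : (0 : ℝ) < r.den := by exact_mod_cast r.den_pos
  set m : ℤ := round (y * r.den)
  have hcop : IsCoprime r.num (r.den : ℤ) := by
    rw [Int.isCoprime_iff_gcd_eq_one]; exact r.reduced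
  obtain ⟨u, v, huv⟩ := hcop
  set J : ℤ := (m * u) % (r.den : ℤ) with hJ
  have hJ0 : 0 ≤ J := Int.emod_nonneg _ (by exact_mod_cast r.den_pos.ne')
  have hJ1 : J < r.den := Int.emod_lt_of_pos _ (by exact_mod_cast r.den_pos)
  obtain ⟨j, hj⟩ := Int.eq_ofNat_of_zero_le hJ0
  have hdvd : (r.den : ℤ) ∣ J * r.num - m := by
    have h1 : (r.den : ℤ) ∣ m * u - J := Int.dvd_self_sub_emod
    have h2 : J * r.num - m = -(m * u - J) * r.num - m * v * r.den := by
      linear_combination m * huv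
    rw [h2]
    exact dvd_sub (Dvd.dvd.mul_right (dvd_neg.2 h1) _) (Dvd.intro_left _ rfl)
  obtain ⟨t, ht⟩ := hdvd
  refine ⟨j, by omega, ?_⟩
  rw [freq_pow]
  refine (norm_freq_sub_freq_le _ _ t).trans ?_
  have hr' : (r : ℝ) = r.num / r.den := by exact_mod_cast (Rat.num_div_den r).symm
  have htR : (j : ℝ) * r.num - m = r.den * t := by
    rw [hj] at ht; exact_mod_cast ht
  have e : (j : ℝ) * Φ - y - t = j * (Φ - r) + (m - y * r.den) / r.den := by
    rw [hr']; field_simp; linear_combination htR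
  have b1 : |(j : ℝ) * (Φ - r)| ≤ 1 / r.den := by
    rw [abs_mul, abs_of_nonneg (by positivity)]
    have : (j : ℝ) ≤ r.den := by exact_mod_cast (by omega : j ≤ r.den)
    calc (j : ℝ) * |Φ - r| ≤ r.den * (1 / (r.den : ℝ) ^ 2) := by gcongr
      _ = 1 / r.den := by field_simp
  have b2 : |((m : ℝ) - y * r.den) / r.den| ≤ 1 / 2 / r.den := by
    rw [abs_div, abs_of_pos hq]
    gcongr
    rw [abs_sub_comm]; exact abs_sub_round _
  have b3 : |(j : ℝ) * Φ - y - t| ≤ 3 / 2 / r.den := by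
    rw [e]
    refine (abs_add_le _ _).trans ((add_le_add b1 b2).trans_eq ?_)
    field_simp; norm_num
  calc 2 * Real.pi * |(j : ℝ) * Φ - y - t| ≤ 2 * Real.pi * (3 / 2 / r.den) := by gcongr
    _ = 3 * Real.pi / r.den := by ring
    _ ≤ 10 / r.den := by gcongr; linarith [Real.pi_lt_d2]

lemma exists_orbit_near {Φ : ℝ} {r : ℚ} (hr : |Φ - r| < 1 / (r.den : ℝ) ^ 2) {ζ₀ ζ : ℂ}
    (h : ‖ζ‖ = ‖ζ₀‖) (h0 : ζ₀ ≠ 0) :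
    ∃ j < r.den, ‖freq Φ ^ j * ζ₀ - ζ‖ ≤ 10 / r.den * ‖ζ₀‖ := by
  have h1 : ‖ζ / ζ₀‖ = 1 := by rw [norm_div, h, div_self (norm_ne_zero_iff.2 h0)]
  obtain ⟨x, hx⟩ := (Complex.norm_eq_one_iff _).1 h1
  have hpi := Real.pi_pos
  have h2 : freq (x / (2 * Real.pi)) = ζ / ζ₀ := by
    rw [← hx, freq]; congr 1; push_cast; field_simp
  obtain ⟨j, hj, hj'⟩ := exists_freq_near hr (x / (2 * Real.pi))
  refine ⟨j, hj, ?_⟩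
  rw [h2] at hj'
  have : freq Φ ^ j * ζ₀ - ζ = (freq Φ ^ j - ζ / ζ₀) * ζ₀ := by field_simp
  rw [this, norm_mul]
  gcongr

/-- A polynomial of degree small compared with the denominator of a convergent is controlled on a
circle by its values along an orbit of the rotation. -/
lemma norm_sum_pow_smul_le_of_orbit (d : ℕ) (X : ℕ → E) {Φ : ℝ} {r : ℚ}
    (hr : |Φ - r| < 1 / (r.den : ℝ) ^ 2) (hd : 60 * (d + 1) ≤ (r.den : ℝ)) {ζ₀ : ℂ} (h0 : ζ₀ ≠ 0)
    {b : ℝ} (hb : ∀ j < r.den, ‖∑ l ∈ Finset.range (d + 1), (freq Φ ^ j * ζ₀) ^ l • X l‖ ≤ b)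
    {ζ : ℂ} (hζ : ‖ζ‖ = ‖ζ₀‖) : ‖∑ l ∈ Finset.range (d + 1), ζ ^ l • X l‖ ≤ 2 * b := by
  set P : ℂ → E := fun ζ => ∑ l ∈ Finset.range (d + 1), ζ ^ l • X l with hPdef
  have hP : Continuous P := (differentiable_sum_pow_smul d X).continuous
  have hq : (0 : ℝ) < r.den := by exact_mod_cast r.den_pos
  have hρ : 0 < ‖ζ₀‖ := norm_pos_iff.2 h0
  obtain ⟨ξ, hξ, hmax⟩ := (isCompact_sphere (0 : ℂ) ‖ζ₀‖).exists_isMaxOn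
    ⟨ζ₀, by simp⟩ hP.norm.continuousOn
  have hmax' : ∀ w : ℂ, ‖w‖ = ‖ζ₀‖ → ‖P w‖ ≤ ‖P ξ‖ := fun w hw => hmax (by simpa using hw)
  rw [mem_sphere_zero_iff_norm] at hξ
  obtain ⟨j, hj, hj'⟩ := exists_orbit_near hr hξ h0
  have hn : ‖freq Φ ^ j * ζ₀‖ = ‖ζ₀‖ := by simp [norm_freq]
  have h1 := norm_sum_pow_smul_sub_le d X hρ hmax' hξ hn
  have h2 : 3 * ‖P ξ‖ * (d + 1) / ‖ζ₀‖ * ‖ξ - freq Φ ^ j * ζ₀‖ ≤ ‖P ξ‖ / 2 := by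
    rw [norm_sub_rev]
    calc _ ≤ 3 * ‖P ξ‖ * (d + 1) / ‖ζ₀‖ * (10 / r.den * ‖ζ₀‖) := by gcongr
      _ = ‖P ξ‖ / 2 * ((60 * (d + 1)) / r.den) := by field_simp; ring
      _ ≤ ‖P ξ‖ / 2 * 1 := by
        gcongr; rwa [div_le_one hq]
      _ = _ := mul_one _
  have h3 := norm_sub_norm_le (P ξ) (P (freq Φ ^ j * ζ₀))
  have h4 := hb j hj
  have h5 := hmax' ζ hζ
  change ‖P ζ‖ ≤ _
  change ‖P (freq Φ ^ j * ζ₀)‖ ≤ b at h4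
  change ‖P ξ - P (freq Φ ^ j * ζ₀)‖ ≤ _ at h1
  linarith

end Sampling

lemma exists_rat_large_den {Φ : ℝ} (hΦ : Irrational Φ) (Q : ℕ) :
    ∃ r : ℚ, Q ≤ r.den ∧ |Φ - r| < 1 / (r.den : ℝ) ^ 2 := by
  by_contra! hcon
  have hinf := Real.infinite_rat_abs_sub_lt_one_div_den_sq_of_irrational hΦ
  obtain ⟨B, hB⟩ := exists_nat_ge ((|Φ| + 1) * Q)
  refine hinf (Set.Finite.of_finite_image (f := fun r : ℚ => (r.num, r.den))
    (((Set.finite_Icc (-(B : ℤ)) B).prod (Set.finite_Iio Q)).subset ?_) ?_)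
  · rintro _ ⟨r, hr, rfl⟩
    have hr : |Φ - r| < 1 / (r.den : ℝ) ^ 2 := hr
    have hden : r.den < Q := by
      by_contra! h
      exact absurd hr (not_lt.2 (hcon r h))
    have h1 : (1 : ℝ) ≤ r.den := by exact_mod_cast r.den_pos
    have h2 : |(r : ℝ)| ≤ |Φ| + 1 := by
      have h3 : 1 / (r.den : ℝ) ^ 2 ≤ 1 := by
        rw [div_le_one (by positivity)]; exact one_le_pow₀ h1
      have h4 := abs_sub_abs_le_abs_sub (r : ℝ) Φ
      rw [abs_sub_comm] at h4; linarith
    have h5 : |(r.num : ℝ)| ≤ B := by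
      have : (r.num : ℝ) = r * r.den := by exact_mod_cast (Rat.mul_den_eq_num r).symm
      rw [this, abs_mul, Nat.abs_cast]
      refine le_trans ?_ hB
      gcongr
    have h6 : |r.num| ≤ (B : ℤ) := by exact_mod_cast h5
    exact ⟨abs_le.1 h6, hden⟩
  · intro r _ r' _ h
    simp only [Prod.mk.injEq] at h
    exact Rat.ext h.1 h.2

namespace TrigCocycle
variable {A : TrigCocycle} {ω : ℂ}

lemma norm_prod_freq_mul_le (hω : ‖ω‖ = 1) (hA : ∀ ζ ≠ 0, (A.eval ζ).det = 1) {s c : ℝ}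
    (hc : ∀ ζ : ℂ, ‖ζ‖ = Real.exp s → ‖A.eval ζ‖ ≤ c) (n j : ℕ) {ζ : ℂ} (hζ : ‖ζ‖ = Real.exp s) :
    ‖A.prod ω n (ω ^ j * ζ)‖ ≤ (c ^ 2) ^ j * ‖A.prod ω n ζ‖ := by
  have step : ∀ ξ : ℂ, ‖ξ‖ = Real.exp s → ‖A.prod ω n (ω * ξ)‖ ≤ c ^ 2 * ‖A.prod ω n ξ‖ := by
    intro ξ hξ
    have h1 : A.prod ω n (ω * ξ) * A.eval ξ = A.eval (ω ^ n * ξ) * A.prod ω n ξ := by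
      have h2 := A.prod_add ω n 1 ξ
      simp only [prod, pow_zero, one_mul, mul_one, pow_one] at h2
      exact h2.symm
    have h3 : A.prod ω n (ω * ξ) = A.eval (ω ^ n * ξ) * A.prod ω n ξ * (A.eval ξ).adjugate := by
      rw [← h1, mul_assoc, Matrix.mul_adjugate, hA ξ (ne_zero_of_norm hξ), one_smul, mul_one]
    have hc0 : 0 ≤ c := (norm_nonneg _).trans (hc ξ hξ)
    rw [h3]
    calc _ ≤ ‖A.eval (ω ^ n * ξ)‖ * ‖A.prod ω n ξ‖ * ‖(A.eval ξ).adjugate‖ :=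
          (Matrix.frobenius_norm_mul _ _).trans
            (mul_le_mul_of_nonneg_right (Matrix.frobenius_norm_mul _ _) (norm_nonneg _))
      _ ≤ c * ‖A.prod ω n ξ‖ * c := by
          rw [norm_adjugate]
          gcongr
          · exact hc _ (by rw [norm_pow_mul hω, hξ])
          · exact hc ξ hξ
      _ = _ := by ring
  induction j with
  | zero => simp
  | succ j ih =>
    have := step (ω ^ j * ζ) (by rw [norm_pow_mul hω, hζ])
    rw [pow_succ' ω, mul_assoc, pow_succ' (c ^ 2), mul_assoc]
    exact this.trans (mul_le_mul_of_nonneg_left ih (sq_nonneg c))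

lemma exists_coeff_decay (hω : ‖ω‖ = 1) (hA : ∀ ζ ≠ 0, (A.eval ζ).det = 1) {s σ : ℝ}
    (hd : HasDerivAt (A.rate ω) σ s) {τ : ℝ} (hτ : 0 < τ) :
    ∃ ε > 0, ∀ᶠ n : ℕ in Filter.atTop, ∀ k : ℤ, n * τ ≤ |k - n * σ| →
      Real.exp (k * s) * ‖A.coeff ω n k‖ ≤ Real.exp (n * (A.rate ω s - ε)) := by
  have h1 := (hasDerivAt_iff_isLittleO_nhds_zero.1 hd).def (c := τ / 2) (by positivity)
  obtain ⟨R, hR, hball⟩ := Metric.eventually_nhds_iff.1 h1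
  set r := R / 2 with hr
  have hr0 : 0 < r := by positivity
  have hp := hball (y := r) (by rw [Real.dist_eq, sub_zero, abs_of_pos hr0]; linarith)
  have hm := hball (y := -r) (by rw [Real.dist_eq, sub_zero, abs_neg, abs_of_pos hr0]; linarith)
  simp only [smul_eq_mul, norm_neg, Real.norm_eq_abs, abs_of_pos hr0] at hp hm
  have hp := (abs_le.1 hp).2
  have hm := (abs_le.1 hm).2
  refine ⟨τ * r / 4, by positivity, ?_⟩
  filter_upwards [eventually_growth_le hω hA (s + r) (c := A.rate ω (s + r) + τ * r / 4)
      (by linarith [mul_pos hτ hr0]),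
    eventually_growth_le hω hA (s + -r) (c := A.rate ω (s + -r) + τ * r / 4)
      (by linarith [mul_pos hτ hr0])] with n hn1 hn2 k hk
  have c1 := (exp_mul_norm_coeff_le (A := A) hω n k (s + r)).trans hn1
  have c2 := (exp_mul_norm_coeff_le (A := A) hω n k (s + -r)).trans hn2
  have key : ∀ u c : ℝ, Real.exp (k * (s + u)) * ‖A.coeff ω n k‖ ≤ Real.exp c →
      Real.exp (k * s) * ‖A.coeff ω n k‖ ≤ Real.exp (c - k * u) := by
    intro u c h
    have : Real.exp (k * s) * ‖A.coeff ω n k‖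
        = Real.exp (-(k * u)) * (Real.exp (k * (s + u)) * ‖A.coeff ω n k‖) := by
      rw [← mul_assoc, ← Real.exp_add]; ring_nf
    rw [this, sub_eq_neg_add, Real.exp_add]
    gcongr
  have hn0 : (0 : ℝ) ≤ n := n.cast_nonneg
  rcases le_abs'.1 hk with hk | hk
  · refine (key _ _ c2).trans (Real.exp_le_exp.2 ?_)
    nlinarith [mul_le_mul_of_nonneg_left hm hn0, mul_le_mul_of_nonneg_right hk hr0.le]
  · refine (key _ _ c1).trans (Real.exp_le_exp.2 ?_)
    nlinarith [mul_le_mul_of_nonneg_left hp hn0, mul_le_mul_of_nonneg_right hk hr0.le]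

lemma norm_prod_sub_window_le (hω : ω ≠ 0) (n : ℕ) {s b : ℝ} (hb : 0 ≤ b) (k₀ : ℤ) (d : ℕ)
    (h : ∀ k : ℤ, k < k₀ ∨ k₀ + d < k → Real.exp (k * s) * ‖A.coeff ω n k‖ ≤ b)
    {ζ : ℂ} (hζ : ‖ζ‖ = Real.exp s) :
    ‖A.prod ω n ζ - ζ ^ k₀ • ∑ l ∈ Finset.range (d + 1), ζ ^ l • A.coeff ω n (k₀ + l)‖
      ≤ (2 * n + 1) * b := by
  have hζ0 := ne_zero_of_norm hζ
  have e1 : ζ ^ k₀ • ∑ l ∈ Finset.range (d + 1), ζ ^ l • A.coeff ω n (k₀ + l)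
      = ∑ k ∈ Finset.Icc k₀ (k₀ + d), ζ ^ k • A.coeff ω n k := by
    rw [Finset.smul_sum]
    refine Finset.sum_bij (fun l _ => k₀ + l) ?_ ?_ ?_ ?_
    · intro l hl; simp at hl ⊢; omega
    · intro l _ l' _ h; omega
    · intro k hk
      simp only [Finset.mem_Icc] at hk
      exact ⟨(k - k₀).toNat, by simp; omega, by omega⟩
    · intro l _
      rw [smul_smul, zpow_add₀ hζ0, zpow_natCast]
  have e2 : ∑ k ∈ Finset.Icc k₀ (k₀ + d), ζ ^ k • A.coeff ω n k
      = ∑ k ∈ Finset.Icc (-(n : ℤ)) n with k ∈ Finset.Icc k₀ (k₀ + d),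
        ζ ^ k • A.coeff ω n k := by
    symm
    refine Finset.sum_subset (fun k hk => (Finset.mem_filter.1 hk).2) fun k hk hk' => ?_
    rw [A.coeff_eq_zero ω n k, smul_zero]
    by_contra hcon
    refine hk' (Finset.mem_filter.2 ⟨Finset.mem_Icc.2 (abs_le.1 (not_lt.1 hcon)), hk⟩)
  rw [A.prod_eq_sum hω n hζ0, e1, e2,
    ← Finset.sum_filter_add_sum_filter_not _ (fun k => k ∈ Finset.Icc k₀ (k₀ + d)),
    add_sub_cancel_left]
  refine (norm_sum_le_of_le (n := fun _ => b) _ fun k hk => ?_).trans ?_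
  · rw [norm_smul, norm_zpow, hζ, ← exp_int_cast_mul]
    refine h k ?_
    have := (Finset.mem_filter.1 hk).2
    simp only [Finset.mem_Icc, not_and_or, not_le] at this
    exact this
  · rw [Finset.sum_const, nsmul_eq_mul]
    gcongr
    have h1 := Finset.card_filter_le (Finset.Icc (-(n : ℤ)) n) (fun k => k ∉ Finset.Icc k₀ (k₀ + d))
    rw [Int.card_Icc, show ((n : ℤ) + 1 - -(n : ℤ)).toNat = 2 * n + 1 by omega] at h1
    exact_mod_cast h1

lemma eventually_tail_lt_one {δ ε : ℝ} (hδ : 0 < δ) (hε : 0 < ε) :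
    ∀ᶠ n : ℕ in Filter.atTop,
      2 * Real.exp (-(n * (δ / 2))) + 3 * ((2 * n + 1) * Real.exp (-(n * ε))) < 1 := by
  have hN := tendsto_natCast_atTop_atTop (R := ℝ)
  have t1 : Filter.Tendsto (fun n : ℕ => Real.exp (-(n * (δ / 2)))) Filter.atTop (nhds 0) :=
    Real.tendsto_exp_neg_atTop_nhds_zero.comp (hN.atTop_mul_const (by positivity))
  have t2 : Filter.Tendsto (fun n : ℕ => Real.exp (-(n * ε))) Filter.atTop (nhds 0) :=
    Real.tendsto_exp_neg_atTop_nhds_zero.comp (hN.atTop_mul_const hε)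
  have t3 : Filter.Tendsto (fun n : ℕ => (n : ℝ) * Real.exp (-(n * ε))) Filter.atTop (nhds 0) := by
    have h1 := (Real.tendsto_pow_mul_exp_neg_atTop_nhds_zero 1).comp (hN.atTop_mul_const hε)
    have h2 := h1.const_mul ε⁻¹
    rw [mul_zero] at h2
    refine h2.congr fun n => ?_
    simp only [Function.comp, pow_one]
    field_simp
  have t4 := (t1.const_mul 2).add (((t3.const_mul 2).add t2).const_mul 3)
  simp only [mul_zero, add_zero] at t4
  filter_upwards [t4.eventually_lt_const one_pos] with n hn
  refine lt_of_eq_of_lt ?_ hn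
  ring

/-- At a point of differentiability of the rate, the products of suitable lengths grow at nearly
the maximal rate uniformly on the circle. -/
theorem exists_norm_prod_ge {Φ : ℝ} (hΦ : Irrational Φ) (hA : ∀ ζ ≠ 0, (A.eval ζ).det = 1)
    {s σ : ℝ} (hd : HasDerivAt (A.rate (freq Φ)) σ s) {δ : ℝ} (hδ : 0 < δ) :
    ∃ᶠ n : ℕ in Filter.atTop, ∀ ζ : ℂ, ‖ζ‖ = Real.exp s →
      Real.exp ((2 * n : ℕ) * (A.rate (freq Φ) s - δ)) ≤ ‖A.prod (freq Φ) (2 * n) ζ‖ := by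
  set ω := freq Φ
  have hω : ‖ω‖ = 1 := norm_freq Φ
  have hω0 : ω ≠ 0 := Complex.exp_ne_zero _
  set Λ := A.rate ω s
  set c : ℝ := max 1 ((Real.exp s)⁻¹ * ‖A.lo‖ + ‖A.mid‖ + Real.exp s * ‖A.hi‖)
  have hc1 : 1 ≤ c := le_max_left _ _
  have hc : ∀ ζ : ℂ, ‖ζ‖ = Real.exp s → ‖A.eval ζ‖ ≤ c :=
    fun ζ hζ => (A.norm_eval_le hζ).trans (le_max_right _ _)
  obtain ⟨K, hK⟩ := exists_nat_ge (max 1 (2 * Real.log c / δ))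
  have hK1 : (1 : ℝ) ≤ K := (le_max_left _ _).trans hK
  have hK2 : 2 * Real.log c ≤ K * δ := (div_le_iff₀ hδ).1 ((le_max_right _ _).trans hK)
  set τ : ℝ := 1 / (480 * K) with hτ
  have hτ0 : 0 < τ := by positivity
  obtain ⟨ε, hε, hdecay⟩ := exists_coeff_decay hω hA hd hτ0
  obtain ⟨N₀, hN₀⟩ := Filter.eventually_atTop.1 (hdecay.and (eventually_tail_lt_one hδ hε))
  rw [Filter.frequently_atTop]
  intro Q
  obtain ⟨r, hrden, hr⟩ := exists_rat_large_den hΦ (max (max Q N₀) 360)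
  set q := r.den
  have hKN : 1 ≤ K := by exact_mod_cast hK1
  have hqn : q ≤ K * q := Nat.le_mul_of_pos_left _ hKN
  have hq1 : max Q N₀ ≤ q := (le_max_left _ _).trans hrden
  have hq2 : Q ≤ q := (le_max_left _ _).trans hq1
  have hq3 : N₀ ≤ q := (le_max_right _ _).trans hq1
  have hq4 : 360 ≤ q := (le_max_right _ _).trans hrden
  refine ⟨K * q, by omega, fun ζ₀ hζ₀ => ?_⟩
  by_contra! hlt
  set N : ℕ := 2 * (K * q) with hNdef
  obtain ⟨hdec, htail⟩ := hN₀ N (by omega)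
  have hNR : (N : ℝ) = 2 * (K * q) := by rw [hNdef]; push_cast; ring
  have hq5 : (360 : ℝ) ≤ q := by exact_mod_cast hq4
  have hNτ : N * τ = q / 240 := by rw [hNR, hτ]; field_simp; norm_num
  set k₀ : ℤ := ⌊N * σ - N * τ⌋
  set d : ℕ := ⌈2 * (N * τ)⌉₊ + 1
  have hd1 : (d : ℝ) ≤ 2 * (N * τ) + 2 := by
    have := Nat.ceil_lt_add_one (a := 2 * (N * τ)) (by positivity)
    simp only [d]; push_cast; linarith
  have hd2 : 2 * (N * τ) + 1 ≤ (d : ℝ) := by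
    have := Nat.le_ceil (2 * (N * τ))
    simp only [d]; push_cast; linarith
  set b := Real.exp (N * (Λ - ε))
  have hwin : ∀ k : ℤ, k < k₀ ∨ k₀ + d < k → Real.exp (k * s) * ‖A.coeff ω N k‖ ≤ b := by
    intro k hk
    refine hdec k (le_abs'.2 ?_)
    have f1 : (k₀ : ℝ) ≤ N * σ - N * τ := Int.floor_le _
    have f2 : N * σ - N * τ < k₀ + 1 := Int.lt_floor_add_one _
    rcases hk with hk | hk
    · left
      have : (k : ℝ) < k₀ := by exact_mod_cast hk
      linarith
    · right
      have : (k₀ : ℝ) + d < k := by exact_mod_cast hk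
      linarith
  have happ : ∀ {ζ : ℂ}, ‖ζ‖ = Real.exp s → _ :=
    fun {ζ} hζ => norm_prod_sub_window_le (A := A) hω0 N (Real.exp_pos _).le k₀ d hwin hζ
  set T := (2 * N + 1) * b
  set P : ℂ → 𝕄 := fun ζ => ∑ l ∈ Finset.range (d + 1), ζ ^ l • A.coeff ω N (k₀ + l)
  have hzP : ∀ {ζ : ℂ}, ‖ζ‖ = Real.exp s → ‖ζ ^ k₀ • P ζ‖ = Real.exp (k₀ * s) * ‖P ζ‖ := by
    intro ζ hζ
    rw [norm_smul, norm_zpow, hζ, ← exp_int_cast_mul]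
  set M := Real.exp (N * (Λ - δ / 2)) + T
  have horb : ∀ j < r.den, ‖P (ω ^ j * ζ₀)‖ ≤ Real.exp (-(k₀ * s)) * M := by
    intro j hj
    have hj' : ‖ω ^ j * ζ₀‖ = Real.exp s := by rw [norm_pow_mul hω, hζ₀]
    have g1 := norm_prod_freq_mul_le hω hA hc N j hζ₀
    have g2 : (c ^ 2) ^ j ≤ Real.exp (N * (δ / 2)) := by
      calc (c ^ 2) ^ j ≤ (c ^ 2) ^ q := pow_le_pow_right₀ (one_le_pow₀ hc1) (le_of_lt hj)
        _ = Real.exp (q * (2 * Real.log c)) := by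
          rw [Real.exp_nat_mul, two_mul, Real.exp_add, Real.exp_log (by linarith), sq]
        _ ≤ _ := by
          apply Real.exp_le_exp.2
          rw [hNR]
          nlinarith [mul_le_mul_of_nonneg_left hK2 (by linarith : (0 : ℝ) ≤ q)]
    have g3 : ‖A.prod ω N (ω ^ j * ζ₀)‖ ≤ Real.exp (N * (Λ - δ / 2)) := by
      refine g1.trans ((mul_le_mul g2 hlt.le (norm_nonneg _) (Real.exp_pos _).le).trans_eq ?_)
      rw [← Real.exp_add]; congr 1; ring
    have g4 := happ hj'
    have g5 := norm_sub_norm_le ((ω ^ j * ζ₀) ^ k₀ • P (ω ^ j * ζ₀)) (A.prod ω N (ω ^ j * ζ₀))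
    rw [norm_sub_rev, hzP hj'] at g5
    rw [Real.exp_neg, ← div_eq_inv_mul, le_div_iff₀ (Real.exp_pos _), mul_comm]
    change ‖_ - _ • P _‖ ≤ _ at g4
    simp only [M]
    linarith
  have hdq : 60 * ((d : ℝ) + 1) ≤ r.den := by
    change _ ≤ (q : ℝ)
    linarith
  have hfin : A.growth ω N s ≤ 2 * M + T := by
    refine growth_le N fun ζ hζ => ?_
    have g1 := norm_sum_pow_smul_le_of_orbit d (fun l => A.coeff ω N (k₀ + l)) hr hdq
      (ne_zero_of_norm hζ₀) horb (hζ.trans hζ₀.symm)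
    change ‖P ζ‖ ≤ _ at g1
    have g2 := happ hζ
    change ‖_ - _ • P _‖ ≤ _ at g2
    have g3 := norm_sub_norm_le (A.prod ω N ζ) (ζ ^ k₀ • P ζ)
    rw [hzP hζ] at g3
    have g4 : Real.exp (k₀ * s) * ‖P ζ‖ ≤ 2 * M := by
      calc _ ≤ Real.exp (k₀ * s) * (2 * (Real.exp (-(k₀ * s)) * M)) := by gcongr
        _ = (Real.exp (k₀ * s) * Real.exp (-(k₀ * s))) * (2 * M) := by ring
        _ = 2 * M := by rw [← Real.exp_add, add_neg_cancel, Real.exp_zero, one_mul]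
    linarith
  have hlow := exp_rate_le_growth hω hA s N
  have e1 : Real.exp (N * (Λ - δ / 2)) = Real.exp (N * Λ) * Real.exp (-(N * (δ / 2))) := by
    rw [← Real.exp_add]; congr 1; ring
  have e2 : b = Real.exp (N * Λ) * Real.exp (-(N * ε)) := by
    simp only [b]
    rw [← Real.exp_add]; congr 1; ring
  have : Real.exp (N * Λ) * 1 ≤ Real.exp (N * Λ) *
      (2 * Real.exp (-(N * (δ / 2))) + 3 * ((2 * N + 1) * Real.exp (-(N * ε)))) := by
    calc _ ≤ 2 * M + T := by rw [mul_one]; exact hlow.trans hfin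
      _ = _ := by simp only [M, T]; rw [e1, e2]; ring
  linarith [le_of_mul_le_mul_left this (Real.exp_pos _)]

end TrigCocycle

local notation "𝕍" => Matrix (Fin 2) (Fin 1) ℂ

lemma norm_sq_col (v : 𝕍) : ‖v‖ ^ 2 = ‖v 0 0‖ ^ 2 + ‖v 1 0‖ ^ 2 := by
  rw [Matrix.frobenius_norm_def, ← Real.rpow_natCast, ← Real.rpow_mul]
  · simp [Fin.sum_univ_two]
  · positivity

lemma norm_sq_row (v : Matrix (Fin 1) (Fin 2) ℂ) : ‖v‖ ^ 2 = ‖v 0 0‖ ^ 2 + ‖v 0 1‖ ^ 2 := by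
  rw [Matrix.frobenius_norm_def, ← Real.rpow_natCast, ← Real.rpow_mul]
  · simp [Fin.sum_univ_two]
  · positivity

lemma two_le_norm_sq_of_det {M : 𝕄} (h : M.det = 1) : 2 ≤ ‖M‖ ^ 2 := by
  rw [Matrix.det_fin_two] at h
  have h1 : (1 : ℝ) ≤ ‖M 0 0‖ * ‖M 1 1‖ + ‖M 0 1‖ * ‖M 1 0‖ := by
    rw [← norm_mul, ← norm_mul, ← norm_one (α := ℂ), ← h]; exact norm_sub_le _ _
  have h2 := norm_sq_eq M
  nlinarith [sq_nonneg (‖M 0 0‖ - ‖M 1 1‖), sq_nonneg (‖M 0 1‖ - ‖M 1 0‖)]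

lemma exists_unit_col {M : 𝕄} (h : M.det = 1) : ∃ v : 𝕍, ‖v‖ = 1 ∧ 1 ≤ ‖M * v‖ := by
  have h2 := two_le_norm_sq_of_det h
  rw [norm_sq_eq] at h2
  have key : ∀ v : 𝕍, ‖v‖ ^ 2 = 1 → 1 ≤ ‖M * v‖ ^ 2 → ‖v‖ = 1 ∧ 1 ≤ ‖M * v‖ := by
    intro v h1 h2
    exact ⟨by rwa [pow_eq_one_iff_of_nonneg (norm_nonneg _) two_ne_zero] at h1,
      by rwa [one_le_sq_iff₀ (norm_nonneg _)] at h2⟩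
  rcases le_total 1 (‖M 0 0‖ ^ 2 + ‖M 1 0‖ ^ 2) with h | h
  · refine ⟨!![1; 0], key _ (by simp [norm_sq_col]) ?_⟩
    simpa [norm_sq_col, Matrix.mul_apply, Fin.sum_univ_two] using h
  · refine ⟨!![0; 1], key _ (by simp [norm_sq_col]) ?_⟩
    simp only [norm_sq_col, Matrix.mul_apply, Fin.sum_univ_two]
    simp
    linarith

/-- If `g`, `h` and `g h` all have nearly maximal norm then every vector is expanded either by `g`
or by the inverse of `h`. -/
lemma norm_mul_norm_mul_le (g h : 𝕄) (v : 𝕍) :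
    ‖v‖ * ‖g * h‖ ≤ ‖g * v‖ * ‖h‖ + ‖h.adjugate * v‖ * ‖g‖ := by
  rcases eq_or_ne v 0 with rfl | hv
  · simp
  have hv0 : 0 < ‖v‖ := norm_pos_iff.2 hv
  set w : 𝕍 := !![-star (v 1 0); star (v 0 0)]
  set w' : Matrix (Fin 1) (Fin 2) ℂ := !![-(v 1 0), v 0 0]
  have hw : ‖w‖ = ‖v‖ := by
    rw [← sq_eq_sq₀ (norm_nonneg _) (norm_nonneg _), norm_sq_col, norm_sq_col]
    simp [w, add_comm]
  have hw' : ‖w' * h‖ = ‖h.adjugate * v‖ := by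
    rw [← sq_eq_sq₀ (norm_nonneg _) (norm_nonneg _), norm_sq_row, norm_sq_col,
      Matrix.adjugate_fin_two]
    simp only [w', Matrix.mul_apply, Fin.sum_univ_two]
    simp only [Matrix.of_apply, Matrix.cons_val', Matrix.cons_val_zero, Matrix.cons_val_one,
      Matrix.cons_val_fin_one]
    rw [add_comm (‖_‖ ^ 2)]
    congr 2
    · congr 1; ring
    · rw [← norm_neg]; congr 1; ring
  have hs : ‖v.conjTranspose‖ = ‖v‖ := Matrix.frobenius_norm_conjTranspose v
  have key : (((‖v‖ ^ 2 : ℝ)) : ℂ) • (g * h) = g * v * (v.conjTranspose * h) + g * w * (w' * h) := by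
    have h1 : v * v.conjTranspose + w * w' = (((‖v‖ ^ 2 : ℝ)) : ℂ) • (1 : 𝕄) := by
      have e := norm_sq_col v
      have e2 : (((‖v‖ ^ 2 : ℝ)) : ℂ) = v 0 0 * star (v 0 0) + v 1 0 * star (v 1 0) := by
        rw [e]; push_cast
        simp [Complex.mul_conj, Complex.normSq_eq_norm_sq]
      rw [e2]
      ext i j
      fin_cases i <;> fin_cases j <;>
        simp [w, w', Matrix.mul_apply, Matrix.conjTranspose_apply] <;> ring
    calc _ = g * ((((‖v‖ ^ 2 : ℝ)) : ℂ) • (1 : 𝕄)) * h := by simp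
      _ = _ := by rw [← h1, Matrix.mul_add, Matrix.add_mul]; simp only [Matrix.mul_assoc]
  have hn : ‖v‖ ^ 2 * ‖g * h‖ ≤ ‖g * v‖ * (‖v‖ * ‖h‖) + ‖g‖ * ‖v‖ * ‖h.adjugate * v‖ := by
    calc ‖v‖ ^ 2 * ‖g * h‖ = ‖(((‖v‖ ^ 2 : ℝ)) : ℂ) • (g * h)‖ := by
          rw [norm_smul, Complex.norm_real, Real.norm_of_nonneg (by positivity)]
      _ ≤ ‖g * v * (v.conjTranspose * h)‖ + ‖g * w * (w' * h)‖ := by rw [key]; exact norm_add_le _ _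
      _ ≤ ‖g * v‖ * ‖v.conjTranspose * h‖ + ‖g * w‖ * ‖w' * h‖ :=
          add_le_add (Matrix.frobenius_norm_mul _ _) (Matrix.frobenius_norm_mul _ _)
      _ ≤ _ := by
          rw [hw']
          gcongr
          · rw [← hs]; exact Matrix.frobenius_norm_mul _ _
          · rw [← hw]; exact Matrix.frobenius_norm_mul _ _
  refine le_of_mul_le_mul_left ?_ hv0
  calc _ = ‖v‖ ^ 2 * ‖g * h‖ := by ring
    _ ≤ _ := hn
    _ = _ := by ring

lemma pow_succ_succ_of_det {X : 𝕄} (h : X.det = 1) (m : ℕ) :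
    X ^ (m + 2) = X.trace • X ^ (m + 1) - X ^ m := by
  have h2 : X ^ 2 = X.trace • X - 1 := by
    rw [Matrix.det_fin_two] at h
    rw [sq]
    ext i j
    fin_cases i <;> fin_cases j <;>
      simp [Matrix.mul_apply, Fin.sum_univ_two, Matrix.trace_fin_two] <;>
      first | ring1 | linear_combination -h
  rw [pow_add, h2, mul_sub, mul_one, Matrix.mul_smul, ← pow_succ]

lemma norm_pow_le_of_det {X : 𝕄} (h : X.det = 1) (m : ℕ) :
    ‖X ^ m‖ ≤ (‖(1 : 𝕄)‖ + ‖X‖) * (‖X.trace‖ + 1) ^ m := by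
  set t := ‖X.trace‖
  set C := ‖(1 : 𝕄)‖ + ‖X‖
  have ht : 0 ≤ t := norm_nonneg _
  have hC : 0 ≤ C := by positivity
  induction m using Nat.twoStepInduction with
  | zero => simp [C]
  | one =>
    rw [pow_one, pow_one]
    have : ‖X‖ ≤ C := by simp only [C]; linarith [norm_nonneg (1 : 𝕄)]
    nlinarith
  | more m ih1 ih2 =>
    rw [pow_succ_succ_of_det h]
    refine (norm_sub_le _ _).trans ?_
    rw [norm_smul]
    have h3 : 0 ≤ C * (t + 1) ^ m := by positivity
    calc t * ‖X ^ (m + 1)‖ + ‖X ^ m‖ ≤ t * (C * (t + 1) ^ (m + 1)) + C * (t + 1) ^ m := by gcongr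
      _ = (t * (t + 1) + 1) * (C * (t + 1) ^ m) := by ring
      _ ≤ (t + 1) ^ 2 * (C * (t + 1) ^ m) := by gcongr; nlinarith
      _ = _ := by ring

lemma le_of_forall_pow_le {x y C : ℝ} (hy : 0 < y) (h : ∀ m : ℕ, x ^ m ≤ C * y ^ m) : x ≤ y := by
  by_contra! hlt
  have h1 : 1 < x / y := by rwa [one_lt_div hy]
  obtain ⟨m, hm⟩ := pow_unbounded_of_one_lt C h1
  rw [div_pow, lt_div_iff₀ (by positivity)] at hm
  linarith [h m]

namespace TrigCocycle
variable {A : TrigCocycle} {ω : ℂ}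

/-- Every vector is expanded by a factor comparable to `T` by the `n`-step cocycle, either forward
or backward in time. -/
def Expands (A : TrigCocycle) (ω : ℂ) (n : ℕ) (s T : ℝ) : Prop :=
  ∀ ζ : ℂ, ‖ζ‖ = Real.exp s → ∀ v : Matrix (Fin 2) (Fin 1) ℂ,
    T * ‖v‖ ≤ ‖A.prod ω n (ω ^ n * ζ) * v‖ + ‖(A.prod ω n ζ).adjugate * v‖

lemma expands_of_norm_prod (hω : ‖ω‖ = 1) {n : ℕ} {s T G : ℝ} (hG : 0 < G)
    (h1 : ∀ ζ : ℂ, ‖ζ‖ = Real.exp s → ‖A.prod ω n ζ‖ ≤ G)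
    (h2 : ∀ ζ : ℂ, ‖ζ‖ = Real.exp s → T * G ≤ ‖A.prod ω (2 * n) ζ‖) :
    A.Expands ω n s T := by
  intro ζ hζ v
  have h3 := norm_mul_norm_mul_le (A.prod ω n (ω ^ n * ζ)) (A.prod ω n ζ) v
  rw [← prod_add, ← two_mul] at h3
  have h4 := h1 ζ hζ
  have h5 := h1 (ω ^ n * ζ) (by rw [norm_pow_mul hω, hζ])
  refine le_of_mul_le_mul_right ?_ hG
  calc T * ‖v‖ * G = ‖v‖ * (T * G) := by ring
    _ ≤ ‖v‖ * ‖A.prod ω (2 * n) ζ‖ := by gcongr; exact h2 ζ hζ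
    _ ≤ _ := h3
    _ ≤ ‖A.prod ω n (ω ^ n * ζ) * v‖ * G + ‖(A.prod ω n ζ).adjugate * v‖ * G := by gcongr
    _ = _ := by ring

lemma continuousAt_prod_apply (n : ℕ) (i j : Fin 2) {p : ℂ × ℂ} (h1 : p.1 ≠ 0) (h2 : p.2 ≠ 0) :
    ContinuousAt (fun p : ℂ × ℂ => A.prod p.1 n p.2 i j) p := by
  induction n generalizing i j with
  | zero => exact continuousAt_const
  | succ n ih =>
    have h3 : p.1 ^ n * p.2 ≠ 0 := mul_ne_zero (pow_ne_zero _ h1) h2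
    have h4 : ∀ i j, ContinuousAt (fun p : ℂ × ℂ => A.eval (p.1 ^ n * p.2) i j) p := by
      intro i j
      simp only [eval, Matrix.add_apply, Matrix.smul_apply, smul_eq_mul]
      fun_prop (disch := assumption)
    simp only [prod, Matrix.mul_apply, Fin.sum_univ_two]
    exact ((h4 i 0).mul (ih 0 j)).add ((h4 i 1).mul (ih 1 j))

lemma continuousAt_norm_prod (n : ℕ) {p : ℂ × ℂ} (h1 : p.1 ≠ 0) (h2 : p.2 ≠ 0) :
    ContinuousAt (fun p : ℂ × ℂ => ‖A.prod p.1 n p.2‖) p := by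
  have : (fun p : ℂ × ℂ => ‖A.prod p.1 n p.2‖) = fun p => √(‖A.prod p.1 n p.2 0 0‖ ^ 2
      + ‖A.prod p.1 n p.2 0 1‖ ^ 2 + ‖A.prod p.1 n p.2 1 0‖ ^ 2 + ‖A.prod p.1 n p.2 1 1‖ ^ 2) := by
    funext p
    rw [← norm_sq_eq, Real.sqrt_sq (norm_nonneg _)]
  rw [this]
  have h := fun i j => continuousAt_prod_apply (A := A) n i j h1 h2
  have h00 := h 0 0
  have h01 := h 0 1
  have h10 := h 1 0
  have h11 := h 1 1
  fun_prop

lemma eventually_norm_prod_mem (hω : ω ≠ 0) (n : ℕ) (s : ℝ) {U : Set ℝ} (hU : IsOpen U)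
    (h : ∀ ζ : ℂ, ‖ζ‖ = Real.exp s → ‖A.prod ω n ζ‖ ∈ U) :
    ∀ᶠ ω' in nhds ω, ∀ ζ : ℂ, ‖ζ‖ = Real.exp s → ‖A.prod ω' n ζ‖ ∈ U := by
  have := (isCompact_sphere (0 : ℂ) (Real.exp s)).eventually_forall_of_forall_eventually
    (x₀ := ω) (P := fun ω' ζ => ‖A.prod ω' n ζ‖ ∈ U) (fun ζ hζ => ?_)
  · simpa using this
  · rw [mem_sphere_zero_iff_norm] at hζ
    exact (continuousAt_norm_prod n (p := (ω, ζ)) hω (ne_zero_of_norm hζ)).eventually_mem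
      (hU.mem_nhds (h ζ hζ))

lemma pow_le_norm_prod_mul {n : ℕ} {s T : ℝ} (hω : ‖ω‖ = 1)
    (hA : ∀ ζ ≠ 0, (A.eval ζ).det = 1) (hT : 2 ≤ T) (h : A.Expands ω n s T) {ζ : ℂ}
    (hζ : ‖ζ‖ = Real.exp s) {v : 𝕍} (hv : ‖v‖ = 1) (hv1 : 1 ≤ ‖A.prod ω n ζ * v‖) (k : ℕ) :
    (T - 1) ^ k ≤ ‖A.prod ω ((k + 1) * n) ζ * v‖ := by
  have hω0 : ω ≠ 0 := by rintro rfl; simp at hω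
  set a : ℕ → ℝ := fun k => ‖A.prod ω (k * n) ζ * v‖
  have hrec : ∀ k, T * a (k + 1) ≤ a (k + 2) + a k := by
    intro k
    have hk : ‖ω ^ (k * n) * ζ‖ = Real.exp s := by rw [norm_pow_mul hω, hζ]
    have h1 := h (ω ^ (k * n) * ζ) hk (A.prod ω ((k + 1) * n) ζ * v)
    have e1 : A.prod ω n (ω ^ n * (ω ^ (k * n) * ζ)) * (A.prod ω ((k + 1) * n) ζ * v)
        = A.prod ω ((k + 2) * n) ζ * v := by
      rw [← mul_assoc, ← pow_add, ← Matrix.mul_assoc,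
        show n + k * n = (k + 1) * n by ring, ← prod_add]
      congr 2; ring
    have e2 : (A.prod ω n (ω ^ (k * n) * ζ)).adjugate * (A.prod ω ((k + 1) * n) ζ * v)
        = A.prod ω (k * n) ζ * v := by
      rw [show (k + 1) * n = n + k * n by ring, prod_add, ← Matrix.mul_assoc, ← Matrix.mul_assoc,
        Matrix.adjugate_mul, A.det_prod hω0 hA n (ne_zero_of_norm hk), one_smul, Matrix.one_mul]
    rw [e1, e2] at h1
    exact h1
  have h0 : a 0 = 1 := by simp [a, prod, hv]
  have h1 : 1 ≤ a 1 := by simpa [a] using hv1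
  have step : ∀ k, (T - 1) ^ k ≤ a (k + 1) ∧ a k ≤ a (k + 1) := by
    intro k
    induction k with
    | zero => exact ⟨by simpa using h1, by rw [h0]; exact h1⟩
    | succ k ih =>
      have hr := hrec k
      have hp : 0 ≤ a (k + 1) := norm_nonneg _
      have h2 : (T - 1) * a (k + 1) ≤ a (k + 1 + 1) := by
        have : a (k + 1 + 1) = a (k + 2) := rfl
        linarith [ih.2]
      refine ⟨?_, by nlinarith⟩
      rw [pow_succ']
      exact (mul_le_mul_of_nonneg_left ih.1 (by linarith)).trans h2
  exact (step k).1

lemma prod_mul_period {q : ℕ} (hq : ω ^ q = 1) (m : ℕ) (ζ : ℂ) :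
    A.prod ω (m * q) ζ = A.prod ω q ζ ^ m := by
  induction m with
  | zero => simp [prod]
  | succ m ih =>
    rw [add_mul, one_mul, add_comm, prod_add, mul_comm m q, pow_mul, hq, one_pow, one_mul,
      mul_comm q m, ih, pow_succ']

lemma pow_le_norm_trace_of_expands {n q : ℕ} {s T : ℝ} (hω : ‖ω‖ = 1)
    (hA : ∀ ζ ≠ 0, (A.eval ζ).det = 1) (hT : 2 ≤ T) (h : A.Expands ω n s T)
    (hq : ω ^ q = 1) {ζ : ℂ} (hζ : ‖ζ‖ = Real.exp s) :
    (T - 1) ^ q ≤ (‖(A.prod ω q ζ).trace‖ + 1) ^ n := by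
  have hω0 : ω ≠ 0 := by rintro rfl; simp at hω
  have hdet := fun m => A.det_prod hω0 hA m (ne_zero_of_norm hζ)
  obtain ⟨v, hv, hv1⟩ := exists_unit_col (hdet n)
  set X := A.prod ω q ζ
  refine le_of_forall_pow_le (C := (T - 1) * (‖(1 : 𝕄)‖ + ‖X‖)) (by positivity) fun m => ?_
  rcases Nat.eq_zero_or_pos (q * m) with h0 | hpos
  · rw [← pow_mul, h0, ← pow_mul, pow_zero]
    have h1 := one_le_norm_of_det (M := (1 : 𝕄)) (by simp)
    have h2 : (1 : ℝ) ≤ (‖X.trace‖ + 1) ^ (n * m) :=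
      one_le_pow₀ (by linarith [norm_nonneg X.trace])
    have h3 : 1 ≤ (T - 1) * (‖(1 : 𝕄)‖ + ‖X‖) := by nlinarith [norm_nonneg X]
    exact one_le_mul_of_one_le_of_one_le h3 h2
  · have h1 := pow_le_norm_prod_mul hω hA hT h hζ hv hv1 (q * m - 1)
    rw [show (q * m - 1 + 1) * n = (n * m) * q by rw [Nat.sub_add_cancel hpos]; ring,
      prod_mul_period hq] at h1
    have h2 := (Matrix.frobenius_norm_mul (X ^ (n * m)) v).trans_eq (by rw [hv, mul_one])
    have h3 := norm_pow_le_of_det (hdet q) (n * m)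
    calc ((T - 1) ^ q) ^ m = (T - 1) * (T - 1) ^ (q * m - 1) := by
          rw [← pow_mul, ← pow_succ', Nat.sub_add_cancel hpos]
      _ ≤ (T - 1) * ((‖(1 : 𝕄)‖ + ‖X‖) * (‖X.trace‖ + 1) ^ (n * m)) := by
          gcongr
          · linarith
          · exact (h1.trans h2).trans h3
      _ = _ := by rw [← pow_mul]; ring

end TrigCocycle

namespace TrigCocycle
variable {A : TrigCocycle} {ω : ℂ}

lemma eventually_le_norm_trace {Φ : ℝ} (hΦ : Irrational Φ) (hA : ∀ ζ ≠ 0, (A.eval ζ).det = 1)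
    {s σ L : ℝ} (hd : HasDerivAt (A.rate (freq Φ)) σ s) (hL : 0 < L)
    (hLr : L < A.rate (freq Φ) s) :
    ∀ᶠ ω in nhds (freq Φ), ‖ω‖ = 1 → ∀ q : ℕ, ω ^ q = 1 → ∀ ζ : ℂ, ‖ζ‖ = Real.exp s →
      Real.exp (q * L) ≤ ‖(A.prod ω q ζ).trace‖ + 1 := by
  have hω := norm_freq Φ
  have hω0 : freq Φ ≠ 0 := by intro h; simp [h] at hω
  set Λ := A.rate (freq Φ) s
  set δ := (Λ - L) / 8 with hδ
  have hδ0 : 0 < δ := by simp only [hδ]; linarith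
  obtain ⟨N, hN⟩ := exists_nat_ge (1 / δ)
  obtain ⟨n, hlow, hup, hn⟩ := ((exists_norm_prod_ge hΦ hA hd hδ0).and_eventually
    ((eventually_growth_le hω hA s (c := Λ + δ) (by linarith)).and
      (Filter.eventually_ge_atTop (max N 1)))).exists
  have hn1 : 1 ≤ n := (le_max_right _ _).trans hn
  have hn1R : (1 : ℝ) ≤ n := by exact_mod_cast hn1
  have hnδ : 1 ≤ n * δ := by
    rw [div_le_iff₀ hδ0] at hN
    have : (N : ℝ) ≤ n := by exact_mod_cast (le_max_left _ _).trans hn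
    nlinarith
  have e1 := eventually_norm_prod_mem (A := A) hω0 (2 * n) s
    (isOpen_Ioi (a := Real.exp ((2 * n : ℕ) * (Λ - 2 * δ)))) (fun ζ hζ =>
      lt_of_lt_of_le (Real.exp_lt_exp.2 (by push_cast; nlinarith)) (hlow ζ hζ))
  have e2 := eventually_norm_prod_mem (A := A) hω0 n s
    (isOpen_Iio (a := Real.exp (n * (Λ + 2 * δ)))) (fun ζ hζ =>
      lt_of_le_of_lt ((norm_prod_le_growth hω n hζ).trans hup)
        (Real.exp_lt_exp.2 (by nlinarith)))
  filter_upwards [e1, e2] with ω' h1 h2 hω' q hq ζ hζ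
  set T := Real.exp (n * (Λ - 6 * δ)) with hTdef
  have hexp : A.Expands ω' n s T := by
    refine expands_of_norm_prod hω' (Real.exp_pos (n * (Λ + 2 * δ))) (fun ζ hζ => (h2 ζ hζ).le)
      fun ζ hζ => le_trans (le_of_eq ?_) (h1 ζ hζ).le
    rw [hTdef, ← Real.exp_add]; congr 1; push_cast; ring
  have hTL : 2 * Real.exp (n * L) ≤ T := by
    have h3 : 2 ≤ Real.exp (2 * (n * δ)) := by linarith [Real.add_one_le_exp (2 * (n * δ))]
    calc 2 * Real.exp (n * L) ≤ Real.exp (2 * (n * δ)) * Real.exp (n * L) := by gcongr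
      _ = T := by rw [hTdef, ← Real.exp_add]; congr 1; simp only [hδ]; ring
  have hL1 : 1 ≤ Real.exp (n * L) := Real.one_le_exp (by positivity)
  have h3 := pow_le_norm_trace_of_expands hω' hA (by linarith) hexp hq hζ
  rw [← pow_le_pow_iff_left₀ (Real.exp_pos _).le (by positivity) (Nat.one_le_iff_ne_zero.1 hn1)]
  refine le_trans ?_ h3
  calc Real.exp (q * L) ^ n = Real.exp (n * L) ^ q := by
        rw [← Real.exp_nat_mul, ← Real.exp_nat_mul]; congr 1; ring
    _ ≤ (T - 1) ^ q := by gcongr; linarith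

lemma growth_le_pow (hω : ‖ω‖ = 1) (n : ℕ) :
    A.growth ω n 0 ≤ ‖(1 : 𝕄)‖ * (‖A.lo‖ + ‖A.mid‖ + ‖A.hi‖) ^ n := by
  refine growth_le n fun ζ hζ => ?_
  induction n with
  | zero => simp [prod]
  | succ n ih =>
    have h1 := A.norm_eval_le (ζ := ω ^ n * ζ) (by rw [norm_pow_mul hω, hζ])
    simp only [Real.exp_zero, inv_one, one_mul] at h1
    calc _ ≤ ‖A.eval (ω ^ n * ζ)‖ * ‖A.prod ω n ζ‖ := Matrix.frobenius_norm_mul _ _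
      _ ≤ _ := mul_le_mul h1 ih (norm_nonneg _) (by positivity)
      _ = _ := by ring

lemma eventually_growth_le_mul_exp (hω : ‖ω‖ = 1) (hA : ∀ ζ ≠ 0, (A.eval ζ).det = 1) {c : ℝ}
    (hc : A.rate ω 0 < c) :
    ∃ C, ∀ᶠ ω' in nhds ω, ‖ω'‖ = 1 → ∀ q : ℕ, A.growth ω' q 0 ≤ C * Real.exp (q * c) := by
  have hω0 : ω ≠ 0 := by rintro rfl; simp at hω
  have hc0 : 0 < c := (rate_nonneg hω hA 0).trans_lt hc
  obtain ⟨c', hc', hcc⟩ := exists_between hc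
  obtain ⟨n, hup, hn⟩ := ((eventually_growth_le hω hA 0 hc').and
      (Filter.eventually_ge_atTop 1)).exists
  set K := max 1 (‖A.lo‖ + ‖A.mid‖ + ‖A.hi‖)
  have hn0 : (0 : ℝ) < n := by exact_mod_cast hn
  refine ⟨‖(1 : 𝕄)‖ * K ^ n, ?_⟩
  filter_upwards [eventually_norm_prod_mem (A := A) hω0 n 0
    (isOpen_Iio (a := Real.exp (n * c))) (fun ζ hζ =>
      lt_of_le_of_lt ((norm_prod_le_growth hω n hζ).trans hup)
        (Real.exp_lt_exp.2 (by nlinarith)))] with ω' h hω' q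
  induction q using Nat.strong_induction_on with
  | _ q ih =>
    rcases lt_or_ge q n with hq | hq
    · calc A.growth ω' q 0 ≤ ‖(1 : 𝕄)‖ * (‖A.lo‖ + ‖A.mid‖ + ‖A.hi‖) ^ q := growth_le_pow hω' q
        _ ≤ ‖(1 : 𝕄)‖ * K ^ q := by gcongr; exact le_max_right _ _
        _ ≤ ‖(1 : 𝕄)‖ * K ^ n := by gcongr; exact le_max_left _ _
        _ ≤ _ := le_mul_of_one_le_right (by positivity) (Real.one_le_exp (by positivity))
    · obtain ⟨m, rfl⟩ := Nat.exists_eq_add_of_le hq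
      have h1 : A.growth ω' n 0 ≤ Real.exp (n * c) := growth_le n fun ζ hζ => (h ζ hζ).le
      have h0 := one_le_growth hω' hA m 0
      calc _ ≤ A.growth ω' n 0 * A.growth ω' m 0 := growth_add_le hω' n m 0
        _ ≤ Real.exp (n * c) * (‖(1 : 𝕄)‖ * K ^ n * Real.exp (m * c)) :=
          mul_le_mul h1 (ih m (by omega)) (by linarith) (Real.exp_pos _).le
        _ = _ := by push_cast; rw [add_mul, Real.exp_add]; ring

lemma trace_prod_mul {q : ℕ} (hω : ω ≠ 0) (hA : ∀ ζ ≠ 0, (A.eval ζ).det = 1) (hq : ω ^ q = 1)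
    {ζ : ℂ} (hζ : ζ ≠ 0) : (A.prod ω q (ω * ζ)).trace = (A.prod ω q ζ).trace := by
  have h1 := A.prod_add ω q 1 ζ
  rw [add_comm, A.prod_add ω 1 q ζ, hq, one_mul, pow_one] at h1
  set E := A.prod ω 1 ζ
  have hE : E * E.adjugate = 1 := by
    rw [Matrix.mul_adjugate, A.det_prod hω hA 1 hζ, one_smul]
  have hE' : E.adjugate * E = 1 := by
    rw [Matrix.adjugate_mul, A.det_prod hω hA 1 hζ, one_smul]
  calc _ = (A.prod ω q (ω * ζ) * (E * E.adjugate)).trace := by rw [hE, mul_one]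
    _ = (E * A.prod ω q ζ * E.adjugate).trace := by rw [← mul_assoc, h1]
    _ = _ := by rw [Matrix.trace_mul_comm, ← mul_assoc, hE', one_mul]

lemma trace_prod_eq_sum (hω : ω ≠ 0) (n : ℕ) {ζ : ℂ} (hζ : ζ ≠ 0) :
    (A.prod ω n ζ).trace = ∑ k ∈ Finset.Icc (-(n : ℤ)) n, ζ ^ k • (A.coeff ω n k).trace := by
  rw [A.prod_eq_sum hω n hζ, Matrix.trace_sum]
  simp [Matrix.trace_smul]

lemma trace_coeff_eq_zero {q : ℕ} (hω : ‖ω‖ = 1) (hA : ∀ ζ ≠ 0, (A.eval ζ).det = 1)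
    (hq : IsPrimitiveRoot ω q) {k : ℤ} (hk : k ∈ Finset.Icc (-(q : ℤ)) q) (hk0 : ¬ (q : ℤ) ∣ k) :
    (A.coeff ω q k).trace = 0 := by
  have hω0 : ω ≠ 0 := by rintro rfl; simp at hω
  have h := norm_coeff_le_of_norm_sum_le
    (fun k => (ω ^ k - 1) * (A.coeff ω q k).trace) q one_pos (G := 0) (fun ζ hζ => ?_) hk
  · rw [one_zpow, one_mul, norm_le_zero_iff, mul_eq_zero, sub_eq_zero,
      hq.zpow_eq_one_iff_dvd] at h
    exact h.resolve_left hk0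
  · have hζ0 : ζ ≠ 0 := by rintro rfl; simp at hζ
    have h1 := trace_prod_mul hω0 hA hq.pow_eq_one hζ0
    rw [trace_prod_eq_sum hω0 q hζ0, trace_prod_eq_sum hω0 q (mul_ne_zero hω0 hζ0), ← sub_eq_zero,
      ← Finset.sum_sub_distrib] at h1
    refine le_of_eq (norm_eq_zero.2 (Eq.trans (Finset.sum_congr rfl fun k _ => ?_) h1))
    rw [mul_zpow, smul_eq_mul, smul_eq_mul, smul_eq_mul]; ring

lemma norm_trace_prod_le {q : ℕ} (hω : ‖ω‖ = 1) (hA : ∀ ζ ≠ 0, (A.eval ζ).det = 1) {l : ℝ}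
    (hhi : ∀ n : ℕ, 0 < n → ‖(A.hi ^ n).trace‖ ≤ Real.exp (n * l))
    (hlo : ∀ n : ℕ, 0 < n → ‖(A.lo ^ n).trace‖ ≤ Real.exp (n * l))
    (hq0 : 0 < q) (hq : IsPrimitiveRoot ω q) {ζ : ℂ} {s : ℝ} (hζ : ‖ζ‖ = Real.exp s) :
    ‖(A.prod ω q ζ).trace‖ ≤ 2 * A.growth ω q 0 + 2 * Real.exp (q * (l + |s|)) := by
  have hω0 : ω ≠ 0 := by rintro rfl; simp at hω
  have hqZ : (0 : ℤ) < q := by exact_mod_cast hq0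
  have hsub : ({0, (q : ℤ), -(q : ℤ)} : Finset ℤ) ⊆ Finset.Icc (-(q : ℤ)) q := by
    intro k; simp only [Finset.mem_insert, Finset.mem_singleton, Finset.mem_Icc]; omega
  have hz : ∀ k ∈ Finset.Icc (-(q : ℤ)) q, k ∉ ({0, (q : ℤ), -(q : ℤ)} : Finset ℤ) →
      ζ ^ k • (A.coeff ω q k).trace = 0 := by
    intro k hk hk'
    rw [trace_coeff_eq_zero hω hA hq hk, smul_zero]
    rintro ⟨m, rfl⟩
    simp only [Finset.mem_insert, Finset.mem_singleton, Finset.mem_Icc] at hk hk'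
    have h1 : m ≤ 1 := by nlinarith
    have h2 : -1 ≤ m := by nlinarith
    obtain rfl | rfl | rfl : m = -1 ∨ m = 0 ∨ m = 1 := by omega
    all_goals simp at hk'
  rw [trace_prod_eq_sum hω0 q (ne_zero_of_norm hζ), ← Finset.sum_subset hsub hz,
    Finset.sum_insert (by simp; omega), Finset.sum_insert (by simp; omega), Finset.sum_singleton]
  have hP : ∀ f : ℕ → ℂ, (∀ j, ‖f j‖ = 1) → ‖∏ j ∈ Finset.range q, f j‖ = 1 := by
    intro f hf; rw [norm_prod]; exact Finset.prod_eq_one fun j _ => hf j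
  have t0 : ‖ζ ^ (0 : ℤ) • (A.coeff ω q 0).trace‖ ≤ 2 * A.growth ω q 0 := by
    rw [zpow_zero, one_smul]
    have := exp_mul_norm_coeff_le (A := A) hω q 0 0
    simp only [mul_zero, Real.exp_zero, one_mul] at this
    linarith [norm_trace_le (A.coeff ω q 0)]
  have t1 : ‖ζ ^ (q : ℤ) • (A.coeff ω q q).trace‖ ≤ Real.exp (q * (l + |s|)) := by
    rw [coeff_self, Matrix.trace_smul, norm_smul, norm_smul, hP _ (by simp [hω]), one_mul,
      norm_zpow, hζ, ← exp_int_cast_mul, mul_add, Real.exp_add, mul_comm]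
    refine mul_le_mul (hhi q hq0) (Real.exp_le_exp.2 ?_) (Real.exp_pos _).le (Real.exp_pos _).le
    rw [Int.cast_natCast]
    exact mul_le_mul_of_nonneg_left (le_abs_self s) q.cast_nonneg
  have t2 : ‖ζ ^ (-q : ℤ) • (A.coeff ω q (-q)).trace‖ ≤ Real.exp (q * (l + |s|)) := by
    rw [coeff_neg_self, Matrix.trace_smul, norm_smul, norm_smul, hP _ (by simp [hω]), one_mul,
      norm_zpow, hζ, ← exp_int_cast_mul, mul_add, Real.exp_add, mul_comm]
    refine mul_le_mul (hlo q hq0) (Real.exp_le_exp.2 ?_) (Real.exp_pos _).le (Real.exp_pos _).le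
    rw [Int.cast_neg, Int.cast_natCast, neg_mul, ← mul_neg]
    exact mul_le_mul_of_nonneg_left (neg_le_abs s) q.cast_nonneg
  refine (norm_add_le _ _).trans ?_
  have := norm_add_le (ζ ^ (q : ℤ) • (A.coeff ω q q).trace) (ζ ^ (-q : ℤ) • (A.coeff ω q (-q)).trace)
  linarith

lemma isPrimitiveRoot_freq (r : ℚ) : IsPrimitiveRoot (freq r) r.den := by
  have := Complex.isPrimitiveRoot_exp_rat r
  rw [freq]
  convert this using 2
  push_cast; ring

lemma rate_le_max {Φ : ℝ} (hΦ : Irrational Φ) (hA : ∀ ζ ≠ 0, (A.eval ζ).det = 1) {l : ℝ}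
    (hhi : ∀ n : ℕ, 0 < n → ‖(A.hi ^ n).trace‖ ≤ Real.exp (n * l))
    (hlo : ∀ n : ℕ, 0 < n → ‖(A.lo ^ n).trace‖ ≤ Real.exp (n * l)) {s : ℝ}
    (hd : DifferentiableAt ℝ (A.rate (freq Φ)) s) :
    A.rate (freq Φ) s ≤ max (A.rate (freq Φ) 0) (l + |s|) := by
  have hω := norm_freq Φ
  by_contra! hlt
  obtain ⟨L, hcL, hL⟩ := exists_between hlt
  obtain ⟨c, hc, hcL⟩ := exists_between hcL
  obtain ⟨hc1, hc2⟩ := max_lt_iff.1 hc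
  have hc0 : 0 < c := (rate_nonneg hω hA 0).trans_lt hc1
  obtain ⟨C, hC⟩ := eventually_growth_le_mul_exp hω hA hc1
  have hlow := eventually_le_norm_trace hΦ hA hd.hasDerivAt (hc0.trans hcL) hL
  obtain ⟨ε, hε, hball⟩ := Metric.eventually_nhds_iff.1 (hC.and hlow)
  obtain ⟨Q, hQ⟩ := exists_nat_gt (max (2 * Real.pi / ε) ((2 * C + 3) / (L - c)))
  obtain ⟨hQ1, hQ2⟩ := max_lt_iff.1 hQ
  obtain ⟨r, hrQ, hr⟩ := exists_rat_large_den hΦ Q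
  have hq1 : (1 : ℝ) ≤ r.den := by exact_mod_cast r.den_pos
  have hqQ : (Q : ℝ) ≤ r.den := by exact_mod_cast hrQ
  obtain ⟨h1, h2⟩ := hball (y := freq r) (by
    rw [dist_eq_norm, norm_sub_rev]
    have h1 := norm_freq_sub_freq_le Φ r 0
    rw [Int.cast_zero, sub_zero] at h1
    rw [div_lt_iff₀ hε] at hQ1
    refine h1.trans_lt ?_
    have h2 : 1 / (r.den : ℝ) ^ 2 ≤ 1 / r.den := by
      gcongr; nlinarith
    calc 2 * Real.pi * |Φ - r| < 2 * Real.pi * (1 / r.den) := by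
          gcongr; exact hr.trans_le h2
      _ ≤ ε := by rw [mul_one_div, div_le_iff₀ (by linarith)]; nlinarith)
  have hζ : ‖((Real.exp s : ℝ) : ℂ)‖ = Real.exp s := by simp
  have h3 := h2 (norm_freq r) r.den (isPrimitiveRoot_freq r).pow_eq_one _ hζ
  have h4 := norm_trace_prod_le (norm_freq r) hA hhi hlo r.den_pos (isPrimitiveRoot_freq r) hζ
  have h5 := h1 (norm_freq r) r.den
  have h6 : Real.exp (r.den * (l + |s|)) ≤ Real.exp (r.den * c) := by gcongr
  have h7 : (1 : ℝ) ≤ Real.exp (r.den * c) := Real.one_le_exp (by positivity)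
  have h8 : Real.exp (r.den * L) = Real.exp (r.den * (L - c)) * Real.exp (r.den * c) := by
    rw [← Real.exp_add]; congr 1; ring
  have h9 : Real.exp (r.den * (L - c)) ≤ 2 * C + 3 := by
    refine le_of_mul_le_mul_right ?_ (Real.exp_pos (r.den * c))
    rw [← h8]; linarith
  rw [div_lt_iff₀ (by linarith)] at hQ2
  have h10 := Real.add_one_le_exp (r.den * (L - c))
  nlinarith

lemma hasDerivAt_rate_zero {Φ : ℝ} (hΦ : Irrational Φ) (hA : ∀ ζ ≠ 0, (A.eval ζ).det = 1) {l : ℝ}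
    (hhi : ∀ n : ℕ, 0 < n → ‖(A.hi ^ n).trace‖ ≤ Real.exp (n * l))
    (hlo : ∀ n : ℕ, 0 < n → ‖(A.lo ^ n).trace‖ ≤ Real.exp (n * l))
    (hl : l < A.rate (freq Φ) 0) : HasDerivAt (A.rate (freq Φ)) 0 0 := by
  have hω := norm_freq Φ
  have hlip := lipschitz_rate hω hA
  set Λ := A.rate (freq Φ) 0
  have hle : ∀ s, |s| < Λ - l → A.rate (freq Φ) s ≤ Λ := by
    intro s hs
    by_contra! hlt
    have hopen : IsOpen {u : ℝ | |u| < Λ - l ∧ Λ < A.rate (freq Φ) u} :=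
      (isOpen_lt continuous_abs continuous_const).inter
        (isOpen_lt continuous_const hlip.continuous)
    have hdense : Dense {u : ℝ | DifferentiableAt ℝ (A.rate (freq Φ)) u} :=
      Measure.dense_of_ae hlip.ae_differentiableAt_real
    obtain ⟨u, ⟨hu1, hu2⟩, hu⟩ := hdense.inter_open_nonempty _ hopen ⟨s, hs, hlt⟩
    have := rate_le_max hΦ hA hhi hlo hu
    rcases le_max_iff.1 this with h | h
    · exact absurd h (not_le.2 hu2)
    · linarith
  have heq : A.rate (freq Φ) =ᶠ[nhds 0] fun _ => Λ := by
    filter_upwards [Metric.ball_mem_nhds (0 : ℝ) (sub_pos.2 hl)] with s hs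
    rw [Metric.mem_ball, Real.dist_eq, sub_zero] at hs
    have h1 := hle s hs
    have h2 := hle (-s) (by rwa [abs_neg])
    have h3 := two_mul_rate_le hω hA 0 s
    rw [zero_add, zero_sub] at h3
    simp only [Λ] at *
    linarith
  exact (hasDerivAt_const (0 : ℝ) Λ).congr_of_eventuallyEq heq

/-- If the growth rate exceeds the trivial lower bounds then the cocycle is uniformly expanding. -/
theorem exists_expands {Φ : ℝ} (hΦ : Irrational Φ) (hA : ∀ ζ ≠ 0, (A.eval ζ).det = 1) {l : ℝ}
    (hhi : ∀ n : ℕ, 0 < n → ‖(A.hi ^ n).trace‖ ≤ Real.exp (n * l))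
    (hlo : ∀ n : ℕ, 0 < n → ‖(A.lo ^ n).trace‖ ≤ Real.exp (n * l))
    (hl : max l 0 < A.rate (freq Φ) 0) : ∃ n, A.Expands (freq Φ) n 0 4 := by
  have hω := norm_freq Φ
  obtain ⟨hl1, hl0⟩ := max_lt_iff.1 hl
  have hd := hasDerivAt_rate_zero hΦ hA hhi hlo hl1
  set Λ := A.rate (freq Φ) 0
  obtain ⟨N, hN⟩ := exists_nat_ge (12 / Λ)
  obtain ⟨n, hlow, hup, hn⟩ := ((exists_norm_prod_ge hΦ hA hd (δ := Λ / 4) (by linarith)).and_eventually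
    ((eventually_growth_le hω hA 0 (c := Λ + Λ / 4) (by linarith)).and
      (Filter.eventually_ge_atTop N))).exists
  refine ⟨n, expands_of_norm_prod hω (Real.exp_pos (n * (Λ + Λ / 4)))
    (fun ζ hζ => (norm_prod_le_growth hω n hζ).trans hup) fun ζ hζ => le_trans ?_ (hlow ζ hζ)⟩
  have hnΛ : 12 ≤ n * Λ := by
    rw [div_le_iff₀ hl0] at hN
    have : (N : ℝ) ≤ n := by exact_mod_cast hn
    nlinarith
  have h4 : 4 ≤ Real.exp (n * Λ / 4) := by linarith [Real.add_one_le_exp (n * Λ / 4)]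
  calc _ ≤ Real.exp (n * Λ / 4) * Real.exp (n * (Λ + Λ / 4)) := by gcongr
    _ = _ := by rw [← Real.exp_add]; congr 1; push_cast; ring

end TrigCocycle

section Operators
variable {H : Type*} [NormedAddCommGroup H] [InnerProductSpace ℂ H] [CompleteSpace H]

lemma mem_unitary_of_norm_map_of_surjective {T : H →L[ℂ] H} (h : ∀ x, ‖T x‖ = ‖x‖)
    (hs : Function.Surjective T) : T ∈ unitary (H →L[ℂ] H) := by
  refine IsUnit.mem_unitary_of_star_mul_self ?_ (T.norm_map_iff_adjoint_comp_self.1 h)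
  rw [ContinuousLinearMap.isUnit_iff_bijective]
  exact ⟨(AddMonoidHomClass.isometry_of_norm T h).injective, hs⟩

lemma isUnit_of_isStarNormal_of_norm_le {T : H →L[ℂ] H} (hT : IsStarNormal T) {C : ℝ}
    (h : ∀ x, ‖x‖ ≤ C * ‖T x‖) : IsUnit T := by
  rw [ContinuousLinearMap.isUnit_iff_bijective,
    ContinuousLinearMap.bijective_iff_dense_range_and_antilipschitz]
  refine ⟨?_, C.toNNReal, T.antilipschitz_of_bound fun x => (h x).trans ?_⟩
  · rw [Submodule.topologicalClosure_eq_top_iff, ContinuousLinearMap.IsStarNormal.orthogonal_range hT, Submodule.eq_bot_iff]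
    intro x hx
    have := h x
    rw [LinearMap.mem_ker] at hx
    change T x = 0 at hx
    rw [hx, norm_zero, mul_zero] at this
    exact norm_le_zero_iff.1 this
  · gcongr; exact Real.le_coe_toNNReal C

/-- A point of the spectrum of a unitary operator is an approximate eigenvalue. -/
lemma not_norm_le_of_mem_spectrum {T : H →L[ℂ] H} (hT : T ∈ unitary (H →L[ℂ] H)) {z : ℂ}
    (hz : z ∈ spectrum ℂ T) (C : ℝ) : ¬ ∀ x, ‖x‖ ≤ C * ‖T x - z • x‖ := by
  intro h
  have hn : IsStarNormal (algebraMap ℂ (H →L[ℂ] H) z - T) := by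
    have h1 := (Unitary.mem_iff.1 hT)
    rw [isStarNormal_iff, Commute, SemiconjBy]
    simp only [star_sub, sub_mul, mul_sub, h1.1, h1.2, Algebra.algebraMap_eq_smul_one, star_smul,
      star_one, smul_mul_assoc, mul_smul_comm, one_mul, mul_one, smul_sub, smul_smul,
      mul_comm z]
    abel
  refine hz (isUnit_of_isStarNormal_of_norm_le hn (C := C) fun x => ?_)
  rw [sub_apply, Algebra.algebraMap_eq_smul_one, norm_sub_rev]
  exact h x

end Operators

lemma Summable.of_sq_le_sum {ι : Type*} {f g h : ι → ℝ} (hg : Summable fun i => g i ^ 2)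
    (hh : Summable fun i => h i ^ 2) {C : ℝ} (hf : ∀ i, |f i| ≤ C * (|g i| + |h i|)) :
    Summable fun i => f i ^ 2 := by
  refine ((hg.add hh).mul_left (2 * C ^ 2)).of_nonneg_of_le (fun i => sq_nonneg _) fun i => ?_
  have h1 := pow_le_pow_left₀ (abs_nonneg _) (hf i) 2
  rw [sq_abs] at h1
  nlinarith [sq_nonneg (|g i| - |h i|), sq_abs (g i), sq_abs (h i), sq_nonneg C,
    mul_nonneg (sq_nonneg C) (sq_nonneg (|g i| - |h i|))]

/-- A square-summable sequence which is expanded forward or backward up to an error is bounded by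
the error. -/
lemma tsum_sq_le_of_expands {u ε : ℤ → ℝ} {C : ℝ} {n : ℤ} {N : ℕ}
    (hu0 : ∀ m, 0 ≤ u m) (hu : Summable fun m => u m ^ 2) (hε : Summable fun m => ε m ^ 2)
    (h : ∀ m, 4 * u m ≤ u (m + n) + u (m - n) + C * ∑ j ∈ Finset.range N, ε (m - n + j)) :
    ∑' m, u m ^ 2 ≤ (C * N) ^ 2 * ∑' m, ε m ^ 2 := by
  obtain ⟨S, hS⟩ := hu
  obtain ⟨E, hE⟩ := hε
  have h1 : HasSum (fun m => u (m + n) ^ 2) S := by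
    have e : (fun m => u (m + n) ^ 2) = (fun m => u m ^ 2) ∘ Equiv.addRight n := by
      funext m
      rw [Function.comp_apply, Equiv.coe_addRight]
    rw [e]
    exact (Equiv.addRight _).hasSum_iff.2 hS
  have h2 : HasSum (fun m => u (m - n) ^ 2) S := by
    have e : (fun m => u (m - n) ^ 2) = (fun m => u m ^ 2) ∘ Equiv.addRight (-n) := by
      funext m
      simp only [Function.comp_apply, Equiv.coe_addRight, sub_eq_add_neg]
    rw [e]
    exact (Equiv.addRight _).hasSum_iff.2 hS
  have h3 : HasSum (fun m => ∑ j ∈ Finset.range N, ε (m - n + j) ^ 2)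
      (∑ j ∈ Finset.range N, E) := by
    refine hasSum_sum fun j _ => ?_
    have e : (fun m => ε (m - n + j) ^ 2) = (fun m => ε m ^ 2) ∘ Equiv.addRight (-n + (j : ℤ)) := by
      funext m
      simp only [Function.comp_apply, Equiv.coe_addRight, sub_eq_add_neg, add_assoc]
    rw [e]
    exact (Equiv.addRight _).hasSum_iff.2 hE
  rw [Finset.sum_const, Finset.card_range, nsmul_eq_mul] at h3
  have h4 : 16 * S ≤ 4 * S + 4 * S + 2 * C ^ 2 * N * (N * E) := by
    refine hasSum_le (fun m => ?_) (hS.mul_left 16)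
      (((h1.mul_left 4).add (h2.mul_left 4)).add (h3.mul_left (2 * C ^ 2 * N)))
    have hcs := sq_sum_le_card_mul_sum_sq (s := Finset.range N) (f := fun j => ε (m - n + j))
    rw [Finset.card_range] at hcs
    have h5 := pow_le_pow_left₀ (by linarith [hu0 m]) (h m) 2
    have h6 := mul_le_mul_of_nonneg_left hcs (sq_nonneg C)
    have h7 : ∀ p q x : ℝ, (p + q + x) ^ 2 ≤ 4 * p ^ 2 + 4 * q ^ 2 + 2 * x ^ 2 := by
      intro p q x; nlinarith [sq_nonneg (p - q), sq_nonneg (p + q - x)]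
    linarith [h7 (u (m + n)) (u (m - n)) (C * ∑ j ∈ Finset.range N, ε (m - n + j))]
  have hE0 : 0 ≤ E := hE.nonneg fun m => sq_nonneg _
  have : 0 ≤ C ^ 2 * N * (N * E) := by positivity
  rw [hS.tsum_eq, hE.tsum_eq]
  linarith

lemma norm_col_le (v : 𝕍) : ‖v‖ ≤ ‖v 0 0‖ + ‖v 1 0‖ := by
  refine le_of_sq_le_sq ?_ (by positivity)
  rw [norm_sq_col]
  nlinarith [norm_nonneg (v 0 0), norm_nonneg (v 1 0)]

lemma norm_col_apply_le (v : 𝕍) (i : Fin 2) : ‖v i 0‖ ≤ ‖v‖ := by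
  refine le_of_sq_le_sq ?_ (norm_nonneg _)
  rw [norm_sq_col]
  fin_cases i <;> simp

namespace TrigCocycle
variable {A : TrigCocycle} {ω : ℂ}

lemma exists_norm_sub_prod_le (n : ℕ) : ∃ C, 0 ≤ C ∧
    ∀ (U : ℤ → Matrix (Fin 2) (Fin 1) ℂ) (E : ℤ → ℂ) (ε : ℤ → ℝ), (∀ m, ‖E m‖ = 1) →
      (∀ m, E (m + 1) = ω * E m) → (∀ m, ‖U (m + 1) - A.eval (E m) * U m‖ ≤ ε m) →
      ∀ m, ‖U (m + n) - A.prod ω n (E m) * U m‖ ≤ C * ∑ j ∈ Finset.range n, ε (m + j) := by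
  induction n with
  | zero => exact ⟨0, le_rfl, fun U E ε _ _ _ m => by simp [prod]⟩
  | succ n ih =>
    obtain ⟨C, hC, h⟩ := ih
    set K := ‖A.lo‖ + ‖A.mid‖ + ‖A.hi‖
    refine ⟨max (K * C) 1, by positivity, fun U E ε hE hEω hU m => ?_⟩
    have hE' : E (m + n) = ω ^ n * E m := by
      clear h
      induction n with
      | zero => simp
      | succ n ih => rw [Nat.cast_succ, ← add_assoc, hEω, ih, pow_succ']; ring
    have hε : ∀ m, 0 ≤ ε m := fun m => (norm_nonneg _).trans (hU m)
    have hK : ‖A.eval (E (m + n))‖ ≤ K := by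
      have := A.norm_eval_le (ζ := E (m + n)) (s := 0) (by rw [hE, Real.exp_zero])
      simpa using this
    have e : U (m + (n + 1 : ℕ)) - A.prod ω (n + 1) (E m) * U m
        = (U (m + n + 1) - A.eval (E (m + n)) * U (m + n))
          + A.eval (E (m + n)) * (U (m + n) - A.prod ω n (E m) * U m) := by
      rw [prod, ← hE', Matrix.mul_sub, Matrix.mul_assoc, Nat.cast_succ, ← add_assoc]
      abel
    have hs : 0 ≤ ∑ j ∈ Finset.range n, ε (m + j) := Finset.sum_nonneg fun j _ => hε _
    rw [e, Finset.sum_range_succ]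
    calc _ ≤ ε (m + n) + K * (C * ∑ j ∈ Finset.range n, ε (m + j)) :=
          (norm_add_le _ _).trans (add_le_add (hU _) ((Matrix.frobenius_norm_mul _ _).trans
            (mul_le_mul hK (h U E ε hE hEω hU m) (norm_nonneg _) (by positivity))))
      _ = 1 * ε (m + n) + K * C * ∑ j ∈ Finset.range n, ε (m + j) := by ring
      _ ≤ max (K * C) 1 * ε (m + n) + max (K * C) 1 * ∑ j ∈ Finset.range n, ε (m + j) := by
          gcongr
          · exact hε _
          · exact le_max_right _ _
          · exact le_max_left _ _
      _ = _ := by ring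

lemma Expands.exists_le {n : ℕ} {T : ℝ} (hω : ‖ω‖ = 1) (hA : ∀ ζ ≠ 0, (A.eval ζ).det = 1)
    (h : A.Expands ω n 0 T) : ∃ C,
    ∀ (U : ℤ → Matrix (Fin 2) (Fin 1) ℂ) (E : ℤ → ℂ) (ε : ℤ → ℝ), (∀ m, ‖E m‖ = 1) →
      (∀ m, E (m + 1) = ω * E m) → (∀ m, ‖U (m + 1) - A.eval (E m) * U m‖ ≤ ε m) →
      ∀ m, T * ‖U m‖ ≤ ‖U (m + n)‖ + ‖U (m - n)‖
        + C * ∑ j ∈ Finset.range (n + n), ε (m - n + j) := by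
  obtain ⟨C, hC, hap⟩ := exists_norm_sub_prod_le (A := A) (ω := ω) n
  have hω0 : ω ≠ 0 := by rintro rfl; simp at hω
  set G := A.growth ω n 0
  have hG1 : 1 ≤ G := one_le_growth hω hA n 0
  refine ⟨G * C, fun U E ε hE hEω hU m => ?_⟩
  have hε : ∀ m, 0 ≤ ε m := fun m => (norm_nonneg _).trans (hU m)
  have hEm := hE (m - n)
  have hE' : E m = ω ^ n * E (m - n) := by
    have : ∀ k : ℕ, E (m - n + k) = ω ^ k * E (m - n) := by
      intro k
      induction k with
      | zero => simp
      | succ k ih => rw [Nat.cast_succ, ← add_assoc, hEω, ih, pow_succ']; ring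
    simpa using this n
  have h1 := h (E (m - n)) (by rw [hE, Real.exp_zero]) (U m)
  rw [← hE'] at h1
  have h2 := hap U E ε hE hEω hU m
  have h3 := hap U E ε hE hEω hU (m - n)
  rw [sub_add_cancel] at h3
  set P := A.prod ω n (E (m - n))
  have hP : ‖P.adjugate‖ ≤ G := by
    rw [norm_adjugate]; exact norm_prod_le_growth hω n (by rw [hE, Real.exp_zero])
  have hdet : P.adjugate * P = 1 := by
    rw [Matrix.adjugate_mul, A.det_prod hω0 hA n (by rw [← norm_pos_iff, hE]; exact one_pos),
      one_smul]
  have h4 : ‖P.adjugate * U m‖ ≤ ‖U (m - n)‖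
      + G * (C * ∑ j ∈ Finset.range n, ε (m - n + j)) := by
    have e : P.adjugate * U m = U (m - n) + P.adjugate * (U m - P * U (m - n)) := by
      rw [Matrix.mul_sub, ← Matrix.mul_assoc, hdet, Matrix.one_mul]; abel
    rw [e]
    exact (norm_add_le _ _).trans (add_le_add le_rfl ((Matrix.frobenius_norm_mul _ _).trans
      (mul_le_mul hP h3 (norm_nonneg _) (by positivity))))
  have h5 : ‖A.prod ω n (E m) * U m‖ ≤ ‖U (m + n)‖ + C * ∑ j ∈ Finset.range n, ε (m + j) := by
    have := norm_sub_norm_le (A.prod ω n (E m) * U m) (U (m + n))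
    rw [norm_sub_rev] at this
    linarith
  rw [Finset.sum_range_add]
  have e6 : ∀ j : ℕ, m - n + ((n + j : ℕ) : ℤ) = m + j := by intro j; push_cast; ring
  simp only [e6]
  have hs : 0 ≤ C * ∑ j ∈ Finset.range n, ε (m + j) :=
    mul_nonneg hC (Finset.sum_nonneg fun j _ => hε _)
  nlinarith

end TrigCocycle

lemma sq1_pos {l : ℝ} (hl : 0 < l ∧ l < 1) : 0 < sq1 l :=
  Real.sqrt_pos.2 (by nlinarith [hl.1, hl.2])

lemma sq_add_sq1_sq {l : ℝ} (hl : 0 < l ∧ l < 1) : l ^ 2 + sq1 l ^ 2 = 1 := by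
  rw [sq1, Real.sq_sqrt (by nlinarith [hl.1, hl.2])]; ring

lemma freq_ne_zero (x : ℝ) : freq x ≠ 0 := Complex.exp_ne_zero _

lemma freq_add (x y : ℝ) : freq (x + y) = freq x * freq y := by
  rw [freq, freq, freq, ← Complex.exp_add]; congr 1; push_cast; ring

lemma inv_freq (x : ℝ) : (freq x)⁻¹ = Complex.exp (-(2 * Real.pi * x) * Complex.I) := by
  rw [freq, ← Complex.exp_neg, neg_mul]

lemma conj_freq (x : ℝ) : (starRingEnd ℂ) (freq x) = (freq x)⁻¹ := by
  rw [← Complex.inv_eq_conj (norm_freq x)]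

lemma fS_zero (l x : ℝ) : fS 0 l x = sq1 l := by simp [fS]

lemma gS_zero (l x : ℝ) : gS 0 l x = -l * (freq x)⁻¹ := by
  rw [inv_freq, gS]; simp

lemma conj_gS_zero (l x : ℝ) : (starRingEnd ℂ) (gS 0 l x) = -l * freq x := by
  rw [gS_zero]; simp [conj_freq]

lemma pS_zero (l x : ℝ) : pS 0 l x = l * (freq x)⁻¹ := by
  rw [inv_freq, pS]; simp; left; congr 1; ring

lemma qS_zero (l x : ℝ) : qS 0 l x = l * freq x := by
  rw [freq, qS]; simp; left; congr 1; ring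

/-- The lower component of the coin at `t = 0`. -/
def coinMinus (l : ℝ) (E : ℤ → ℂ) (ψ : ℤ → EuclideanSpace ℂ (Fin 2)) (n : ℤ) : ℂ :=
  -l * E n * ψ n 0 + sq1 l * ψ n 1

/-- The upper component of the coin at `t = 0`. -/
def coinPlus (l : ℝ) (E : ℤ → ℂ) (ψ : ℤ → EuclideanSpace ℂ (Fin 2)) (n : ℤ) : ℂ :=
  sq1 l * ψ n 0 + l * (E n)⁻¹ * ψ n 1

lemma wPlus_zero (l1 l2 Φ θ : ℝ) (ψ : ℤ → EuclideanSpace ℂ (Fin 2)) (n : ℤ) :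
    wPlus 0 l1 l2 Φ θ ψ n = l1 * coinPlus l2 (fun m => freq (θ + m * Φ)) ψ (n - 1)
      - sq1 l1 * coinMinus l2 (fun m => freq (θ + m * Φ)) ψ n := by
  rw [wPlus, conj_gS_zero, gS_zero, fS_zero, fS_zero, coinPlus, coinMinus]
  push_cast
  ring

lemma wMinus_zero (l1 l2 Φ θ : ℝ) (ψ : ℤ → EuclideanSpace ℂ (Fin 2)) (n : ℤ) :
    wMinus 0 l1 l2 Φ θ ψ n = l1 * coinMinus l2 (fun m => freq (θ + m * Φ)) ψ (n + 1)
      + sq1 l1 * coinPlus l2 (fun m => freq (θ + m * Φ)) ψ n := by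
  rw [wMinus, conj_gS_zero, gS_zero, fS_zero, fS_zero, coinPlus, coinMinus]
  push_cast
  ring

/-- The Szegő cocycle at `t = 0` in the variable `ζ = e^{2πix}`. -/
def szego (l1 l2 : ℝ) (z : ℂ) : TrigCocycle where
  lo := ((l1 * sq1 l2 : ℝ) : ℂ)⁻¹ • !![-(sq1 l1 * l2 : ℂ), 0; (l2 : ℂ), 0]
  mid := ((l1 * sq1 l2 : ℝ) : ℂ)⁻¹ • !![z, -(sq1 l1 : ℂ) * z⁻¹; -(sq1 l1 : ℂ) * z, z⁻¹]
  hi := ((l1 * sq1 l2 : ℝ) : ℂ)⁻¹ • !![0, (l2 : ℂ); 0, -(sq1 l1 * l2 : ℂ)]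

lemma eval_szego (l1 l2 : ℝ) (z ζ : ℂ) : (szego l1 l2 z).eval ζ = ((l1 * sq1 l2 : ℝ) : ℂ)⁻¹ •
    !![z - sq1 l1 * l2 * ζ⁻¹, l2 * ζ - sq1 l1 * z⁻¹;
      -(sq1 l1 : ℂ) * z + l2 * ζ⁻¹, -(sq1 l1 * l2 : ℂ) * ζ + z⁻¹] := by
  ext i j
  fin_cases i <;> fin_cases j <;> simp [szego, TrigCocycle.eval] <;> ring

lemma SzP_zero {l1 l2 : ℝ} (hl2 : 0 < l2 ∧ l2 < 1) {z : ℂ} (hz : z ≠ 0) (x : ℝ) :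
    SzP 0 l1 l2 z x = (szego l1 l2 z).eval (freq x) := by
  rw [eval_szego, SzP, fS_zero, abs_of_pos (sq1_pos hl2), Dz, pS_zero, qS_zero, div_eq_mul_inv,
    mul_comm z⁻¹, mul_smul, ← Complex.ofReal_mul]
  congr 1
  ext i j
  fin_cases i <;> fin_cases j <;> simp <;> field_simp

lemma det_eval_szego {l1 l2 : ℝ} (hl1 : 0 < l1 ∧ l1 < 1) (hl2 : 0 < l2 ∧ l2 < 1) {z : ℂ}
    (hz : z ≠ 0) (ζ : ℂ) (hζ : ζ ≠ 0) : ((szego l1 l2 z).eval ζ).det = 1 := by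
  have h1 : (l1 : ℂ) ^ 2 + (sq1 l1 : ℂ) ^ 2 = 1 := by exact_mod_cast sq_add_sq1_sq hl1
  have h2 : (l2 : ℂ) ^ 2 + (sq1 l2 : ℂ) ^ 2 = 1 := by exact_mod_cast sq_add_sq1_sq hl2
  have h3 : (l1 : ℂ) ≠ 0 := by exact_mod_cast hl1.1.ne'
  have h4 : (sq1 l2 : ℂ) ≠ 0 := by exact_mod_cast (sq1_pos hl2).ne'
  rw [eval_szego, Matrix.det_smul, Matrix.det_fin_two_of]
  simp only [Fintype.card_fin, Complex.ofReal_mul]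
  field_simp
  linear_combination -(z * ζ * ((1 - (l2 : ℂ) ^ 2) * h1 + (l1 : ℂ) ^ 2 * h2))

lemma szego_hi_pow (l1 l2 : ℝ) (z : ℂ) (n : ℕ) : (szego l1 l2 z).hi ^ (n + 1)
    = (-((sq1 l1 * l2) / (l1 * sq1 l2) : ℝ) : ℂ) ^ n • (szego l1 l2 z).hi := by
  have h : (szego l1 l2 z).hi * (szego l1 l2 z).hi
      = (-((sq1 l1 * l2) / (l1 * sq1 l2) : ℝ) : ℂ) • (szego l1 l2 z).hi := by
    ext i j
    fin_cases i <;> fin_cases j <;> simp [szego, Matrix.mul_apply, Fin.sum_univ_two]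
      <;> first | ring1 | (left; ring1)
  induction n with
  | zero => simp
  | succ n ih => rw [pow_succ, ih, smul_mul_assoc, h, smul_smul, pow_succ _ n]

lemma szego_lo_pow (l1 l2 : ℝ) (z : ℂ) (n : ℕ) : (szego l1 l2 z).lo ^ (n + 1)
    = (-((sq1 l1 * l2) / (l1 * sq1 l2) : ℝ) : ℂ) ^ n • (szego l1 l2 z).lo := by
  have h : (szego l1 l2 z).lo * (szego l1 l2 z).lo
      = (-((sq1 l1 * l2) / (l1 * sq1 l2) : ℝ) : ℂ) • (szego l1 l2 z).lo := by
    ext i j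
    fin_cases i <;> fin_cases j <;> simp [szego, Matrix.mul_apply, Fin.sum_univ_two]
      <;> first | ring1 | (left; ring1)
  induction n with
  | zero => simp
  | succ n ih => rw [pow_succ, ih, smul_mul_assoc, h, smul_smul, pow_succ _ n]

lemma szego_hi_pow_one_one (l1 l2 : ℝ) (z : ℂ) (n : ℕ) : ((szego l1 l2 z).hi ^ (n + 1)) 1 1
    = (-((sq1 l1 * l2) / (l1 * sq1 l2) : ℝ) : ℂ) ^ (n + 1) := by
  rw [szego_hi_pow, pow_succ]
  simp [szego]
  first | ring1 | (left; ring1)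

lemma trace_szego_hi_pow (l1 l2 : ℝ) (z : ℂ) (n : ℕ) : ((szego l1 l2 z).hi ^ (n + 1)).trace
    = (-((sq1 l1 * l2) / (l1 * sq1 l2) : ℝ) : ℂ) ^ (n + 1) := by
  rw [szego_hi_pow, pow_succ, Matrix.trace_fin_two]
  simp [szego]
  first | ring1 | (left; ring1)

lemma trace_szego_lo_pow (l1 l2 : ℝ) (z : ℂ) (n : ℕ) : ((szego l1 l2 z).lo ^ (n + 1)).trace
    = (-((sq1 l1 * l2) / (l1 * sq1 l2) : ℝ) : ℂ) ^ (n + 1) := by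
  rw [szego_lo_pow, pow_succ, Matrix.trace_fin_two]
  simp [szego]
  first | ring1 | (left; ring1)

section Walk

lemma hasSum_norm_sq_H2 (ψ : H2) : HasSum (fun n => ‖ψ n 0‖ ^ 2 + ‖ψ n 1‖ ^ 2) (‖ψ‖ ^ 2) := by
  have h := lp.hasSum_norm (p := 2) (by norm_num) ψ
  simp only [ENNReal.toReal_ofNat, Real.rpow_ofNat] at h
  refine h.congr_fun fun n => ?_
  rw [EuclideanSpace.norm_sq_eq, Fin.sum_univ_two]

lemma summable_norm_sq_apply_H2 (ψ : H2) (i : Fin 2) : Summable fun n => ‖ψ n i‖ ^ 2 := by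
  refine (hasSum_norm_sq_H2 ψ).summable.of_nonneg_of_le (fun n => by positivity) fun n => ?_
  fin_cases i <;> simp

lemma exists_H2_eq {f g : ℤ → ℂ} (hf : Summable fun n => ‖f n‖ ^ 2)
    (hg : Summable fun n => ‖g n‖ ^ 2) : ∃ ψ : H2, (∀ n, ψ n 0 = f n) ∧ ∀ n, ψ n 1 = g n := by
  have h : Memℓp (fun n => !₂[f n, g n] : ℤ → EuclideanSpace ℂ (Fin 2)) 2 := by
    refine memℓp_gen ((hf.add hg).congr fun n => ?_)
    simp only [ENNReal.toReal_ofNat, Real.rpow_ofNat]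
    rw [EuclideanSpace.norm_sq_eq, Fin.sum_univ_two]
    simp
  exact ⟨⟨_, h⟩, fun n => rfl, fun n => rfl⟩

/-- Rotations of `ℂ²` by real angles and phases preserve the norm. -/
lemma norm_sq_add_norm_sq_rotation {a b : ℝ} (h : a ^ 2 + b ^ 2 = 1) {e : ℂ} (he : ‖e‖ = 1)
    (x y : ℂ) : ‖a * x + b * e⁻¹ * y‖ ^ 2 + ‖-b * e * x + a * y‖ ^ 2 = ‖x‖ ^ 2 + ‖y‖ ^ 2 := by
  have h1 : (a : ℂ) ^ 2 + (b : ℂ) ^ 2 = 1 := by exact_mod_cast h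
  have he0 : e ≠ 0 := by rintro rfl; simp at he
  apply Complex.ofReal_injective
  push_cast
  simp only [← Complex.conj_mul', map_add, map_mul, map_neg, Complex.conj_ofReal,
    ← Complex.inv_eq_conj he, map_inv₀, inv_inv]
  field_simp
  linear_combination e * ((starRingEnd ℂ) x * x + (starRingEnd ℂ) y * y) * h1

lemma norm_sq_coin (hl2 : 0 < l2 ∧ l2 < 1) {E : ℤ → ℂ} (hE : ∀ n, ‖E n‖ = 1)
    (ψ : ℤ → EuclideanSpace ℂ (Fin 2)) (n : ℤ) :
    ‖coinPlus l2 E ψ n‖ ^ 2 + ‖coinMinus l2 E ψ n‖ ^ 2 = ‖ψ n 0‖ ^ 2 + ‖ψ n 1‖ ^ 2 :=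
  norm_sq_add_norm_sq_rotation ((add_comm _ _).trans (sq_add_sq1_sq hl2)) (hE n) _ _

lemma norm_sq_H2_eq (ψ : H2) : ‖ψ‖ ^ 2 = ∑' n, ‖ψ n 0‖ ^ 2 + ∑' n, ‖ψ n 1‖ ^ 2 := by
  rw [← (summable_norm_sq_apply_H2 ψ 0).tsum_add (summable_norm_sq_apply_H2 ψ 1)]
  exact (hasSum_norm_sq_H2 ψ).tsum_eq.symm

lemma Summable.comp_add_int {f : ℤ → ℝ} (hf : Summable f) (k : ℤ) :
    Summable fun n => f (n + k) :=
  hf.comp_injective (add_left_injective k)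

lemma tsum_add_int (f : ℤ → ℝ) (k : ℤ) : ∑' n, f (n + k) = ∑' n, f n :=
  (Equiv.addRight k).tsum_eq f

lemma summable_norm_sq_of_le {f g h : ℤ → ℂ} (hg : Summable fun n => ‖g n‖ ^ 2)
    (hh : Summable fun n => ‖h n‖ ^ 2) (C : ℝ) (hf : ∀ n, ‖f n‖ ≤ C * (‖g n‖ + ‖h n‖)) :
    Summable fun n => ‖f n‖ ^ 2 :=
  Summable.of_sq_le_sum (C := C) hg hh fun n => by simpa using hf n

lemma summable_norm_sq_add {g h u v : ℤ → ℂ} (hg : Summable fun n => ‖g n‖ ^ 2)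
    (hh : Summable fun n => ‖h n‖ ^ 2) (hu : ∀ n, ‖u n‖ ≤ 1) (hv : ∀ n, ‖v n‖ ≤ 1) :
    Summable fun n => ‖u n * g n + v n * h n‖ ^ 2 := by
  refine summable_norm_sq_of_le hg hh 1 fun n => (norm_add_le _ _).trans ?_
  rw [norm_mul, norm_mul]
  nlinarith [norm_nonneg (g n), norm_nonneg (h n), hu n, hv n]

lemma sq1_le_one (l : ℝ) : sq1 l ≤ 1 :=
  Real.sqrt_le_one.2 (by nlinarith [sq_nonneg l])

variable {l1 l2 Φ θ : ℝ}

/-- `W` acts as the walk operator with `t = 0`. -/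
def IsWalk (l1 l2 Φ θ : ℝ) (W : H2 →L[ℂ] H2) : Prop :=
  ∀ (ψ : H2) (n : ℤ),
    W ψ n 0 = l1 * coinPlus l2 (fun m => freq (θ + m * Φ)) (fun m => ψ m) (n - 1)
      - sq1 l1 * coinMinus l2 (fun m => freq (θ + m * Φ)) (fun m => ψ m) n ∧
    W ψ n 1 = l1 * coinMinus l2 (fun m => freq (θ + m * Φ)) (fun m => ψ m) (n + 1)
      + sq1 l1 * coinPlus l2 (fun m => freq (θ + m * Φ)) (fun m => ψ m) n

lemma IsWalk.norm_map {W : H2 →L[ℂ] H2} (hW : IsWalk l1 l2 Φ θ W) (hl1 : 0 < l1 ∧ l1 < 1)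
    (hl2 : 0 < l2 ∧ l2 < 1) (ψ : H2) : ‖W ψ‖ = ‖ψ‖ := by
  have hE : ∀ n : ℤ, ‖freq (θ + n * Φ)‖ = 1 := fun n => norm_freq _
  have hψ := (hasSum_norm_sq_H2 ψ).congr_fun
    (norm_sq_coin hl2 (E := fun n : ℤ => freq (θ + n * Φ)) hE (fun m => ψ m))
  have hp : Summable fun n => ‖coinPlus l2 (fun m : ℤ => freq (θ + m * Φ)) (fun m => ψ m) n‖ ^ 2 :=
    hψ.summable.of_nonneg_of_le (fun n => by positivity) fun n => by simp
  have hm : Summable fun n => ‖coinMinus l2 (fun m : ℤ => freq (θ + m * Φ)) (fun m => ψ m) n‖ ^ 2 :=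
    hψ.summable.of_nonneg_of_le (fun n => by positivity) fun n => by simp
  refine (sq_eq_sq₀ (norm_nonneg _) (norm_nonneg _)).1 ?_
  rw [← hψ.tsum_eq, hp.tsum_add hm, norm_sq_H2_eq, ← tsum_add_int (fun n => ‖W ψ n 1‖ ^ 2) (-1),
    ← tsum_add_int (fun n => ‖coinPlus _ _ _ n‖ ^ 2) (-1),
    ← (summable_norm_sq_apply_H2 _ 0).tsum_add ((summable_norm_sq_apply_H2 _ 1).comp_add_int (-1)),
    ← (hp.comp_add_int (-1)).tsum_add hm]
  congr 1
  funext n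
  have := norm_sq_add_norm_sq_rotation (a := l1) (b := -sq1 l1) (e := 1)
    (by rw [neg_sq]; exact sq_add_sq1_sq hl1) (by simp)
    (coinPlus l2 (fun m : ℤ => freq (θ + m * Φ)) (fun m => ψ m) (n - 1))
    (coinMinus l2 (fun m : ℤ => freq (θ + m * Φ)) (fun m => ψ m) n)
  rw [← sub_eq_add_neg, (hW ψ n).1, (hW ψ (n - 1)).2, sub_add_cancel, ← this]
  congr 3
  · push_cast; ring
  · push_cast; ring

lemma IsWalk.surjective {W : H2 →L[ℂ] H2} (hW : IsWalk l1 l2 Φ θ W) (hl1 : 0 < l1 ∧ l1 < 1)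
    (hl2 : 0 < l2 ∧ l2 < 1) : Function.Surjective W := by
  intro φ
  have hE : ∀ n : ℤ, ‖freq (θ + n * Φ)‖ = 1 := fun n => norm_freq _
  have h1 : (l1 : ℂ) ^ 2 + (sq1 l1 : ℂ) ^ 2 = 1 := by exact_mod_cast sq_add_sq1_sq hl1
  have h2 : (l2 : ℂ) ^ 2 + (sq1 l2 : ℂ) ^ 2 = 1 := by exact_mod_cast sq_add_sq1_sq hl2
  have n1 : ‖(l1 : ℂ)‖ ≤ 1 := by simpa [abs_of_pos hl1.1] using hl1.2.le
  have n2 : ‖(l2 : ℂ)‖ ≤ 1 := by simpa [abs_of_pos hl2.1] using hl2.2.le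
  have n3 : ‖(sq1 l1 : ℂ)‖ ≤ 1 := by simpa [abs_of_pos (sq1_pos hl1)] using sq1_le_one l1
  have n4 : ‖(sq1 l2 : ℂ)‖ ≤ 1 := by simpa [abs_of_pos (sq1_pos hl2)] using sq1_le_one l2
  have hp := summable_norm_sq_apply_H2 φ 0
  have hm := summable_norm_sq_apply_H2 φ 1
  set P : ℤ → ℂ := fun n => l1 * φ (n + 1) 0 + sq1 l1 * φ n 1 with hPdef
  set M : ℤ → ℂ := fun n => l1 * φ (n + -1) 1 + -sq1 l1 * φ n 0 with hMdef
  have hP : Summable fun n => ‖P n‖ ^ 2 :=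
    summable_norm_sq_add (hp.comp_add_int 1) hm (fun _ => n1) (fun _ => n3)
  have hM : Summable fun n => ‖M n‖ ^ 2 :=
    summable_norm_sq_add (hm.comp_add_int (-1)) hp (fun _ => n1) (fun _ => by rwa [norm_neg])
  obtain ⟨ψ, hψ0, hψ1⟩ := exists_H2_eq
    (f := fun n => sq1 l2 * P n + -(l2 * (freq (θ + n * Φ))⁻¹) * M n)
    (g := fun n => l2 * freq (θ + n * Φ) * P n + sq1 l2 * M n)
    (summable_norm_sq_add hP hM (fun _ => n4)
      (fun n => by rw [norm_neg, norm_mul, norm_inv, hE]; simpa using n2))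
    (summable_norm_sq_add hP hM (fun n => by rw [norm_mul, hE]; simpa using n2) (fun _ => n4))
  have hcP : ∀ n, coinPlus l2 (fun m : ℤ => freq (θ + m * Φ)) (fun m => ψ m) n = P n := by
    intro n
    rw [coinPlus, hψ0, hψ1]
    have := freq_ne_zero (θ + n * Φ)
    field_simp
    linear_combination freq (θ + n * Φ) * P n * h2
  have hcM : ∀ n, coinMinus l2 (fun m : ℤ => freq (θ + m * Φ)) (fun m => ψ m) n = M n := by
    intro n
    rw [coinMinus, hψ0, hψ1]
    have := freq_ne_zero (θ + n * Φ)
    field_simp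
    linear_combination M n * h2
  refine ⟨ψ, ?_⟩
  ext n i
  fin_cases i
  · refine (hW ψ n).1.trans ?_
    rw [hcP, hcM]
    simp only [hPdef, hMdef, sub_add_cancel, ← sub_eq_add_neg]
    change _ = φ n 0
    linear_combination φ n 0 * h1
  · refine (hW ψ n).2.trans ?_
    rw [hcP, hcM]
    simp only [hPdef, hMdef, add_neg_cancel_right]
    change _ = φ n 1
    linear_combination φ n 1 * h1

end Walk

section Spectrum
variable {l1 l2 Φ θ : ℝ} {z : ℂ}

/-- The transfer-matrix form of the inhomogeneous eigenvalue equation. -/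
lemma IsWalk.transfer {W : H2 →L[ℂ] H2} (hW : IsWalk l1 l2 Φ θ W) (hl1 : 0 < l1 ∧ l1 < 1)
    (hl2 : 0 < l2 ∧ l2 < 1) (hz : z ≠ 0) (ψ : H2) (m : ℤ) :
    !![coinMinus l2 (fun m => freq (θ + m * Φ)) (fun m => ψ m) (m + 1); z * ψ (m + 1) 0]
      - (szego l1 l2 z).eval (freq (θ + m * Φ)) *
        !![coinMinus l2 (fun m => freq (θ + m * Φ)) (fun m => ψ m) m; z * ψ m 0]
    = !![(W ψ - z • ψ) m 1 / l1;
        -(sq1 l1 * ((W ψ - z • ψ) m 1) / l1) - (W ψ - z • ψ) (m + 1) 0] := by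
  have h1 : (l1 : ℂ) ^ 2 + (sq1 l1 : ℂ) ^ 2 = 1 := by exact_mod_cast sq_add_sq1_sq hl1
  have h2 : (l2 : ℂ) ^ 2 + (sq1 l2 : ℂ) ^ 2 = 1 := by exact_mod_cast sq_add_sq1_sq hl2
  have h3 : (l1 : ℂ) ≠ 0 := by exact_mod_cast hl1.1.ne'
  have h4 : (sq1 l2 : ℂ) ≠ 0 := by exact_mod_cast (sq1_pos hl2).ne'
  have h5 := freq_ne_zero (θ + m * Φ)
  have hm := (hW ψ m).2
  have hp := (hW ψ (m + 1)).1
  rw [add_sub_cancel_right] at hp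
  have e1 : (W ψ - z • ψ) m 1 = W ψ m 1 - z * ψ m 1 := rfl
  have e2 : (W ψ - z • ψ) (m + 1) 0 = W ψ (m + 1) 0 - z * ψ (m + 1) 0 := rfl
  rw [e1, e2, hm, hp, eval_szego]
  set c := coinMinus l2 (fun m => freq (θ + m * Φ)) (fun m => ψ m) (m + 1)
  ext i j
  fin_cases i <;> fin_cases j <;>
    simp [coinMinus, coinPlus] <;> field_simp
  · linear_combination -(freq (θ + m * Φ) * sq1 l1 * ψ m 0) * h2
  · linear_combination (sq1 l2 * l2 * ψ m 1 + freq (θ + m * Φ) * ψ m 0 * sq1 l2 ^ 2) * h1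
      + freq (θ + m * Φ) * ψ m 0 * h2

lemma IsWalk.exists_norm_le {W : H2 →L[ℂ] H2} (hW : IsWalk l1 l2 Φ θ W) (hl1 : 0 < l1 ∧ l1 < 1)
    (hl2 : 0 < l2 ∧ l2 < 1) (hz : ‖z‖ = 1) {n : ℕ}
    (h : (szego l1 l2 z).Expands (freq Φ) n 0 4) :
    ∃ C, ∀ ψ, ‖ψ‖ ≤ C * ‖W ψ - z • ψ‖ := by
  have hz0 : z ≠ 0 := by rintro rfl; simp at hz
  have ha := hl1.1
  have hb := sq1_pos hl2
  have na : ‖(l1 : ℂ)‖ = l1 := by simp [abs_of_pos ha]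
  have na' : ‖(sq1 l1 : ℂ)‖ = sq1 l1 := by simp [abs_of_pos (sq1_pos hl1)]
  have nb : ‖(l2 : ℂ)‖ = l2 := by simp [abs_of_pos hl2.1]
  have nb' : ‖(sq1 l2 : ℂ)‖ = sq1 l2 := by simp [abs_of_pos hb]
  have hE : ∀ m : ℤ, ‖freq (θ + m * Φ)‖ = 1 := fun m => norm_freq _
  have hEs : ∀ m : ℤ, freq (θ + (m + 1 : ℤ) * Φ) = freq Φ * freq (θ + m * Φ) := by
    intro m
    rw [← freq_add]
    congr 1
    push_cast
    ring
  obtain ⟨C, hC⟩ := h.exists_le (norm_freq Φ) (det_eval_szego hl1 hl2 hz0)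
  set K := 1 + (2 / sq1 l2) ^ 2
  set D := K * ((C * (n + n : ℕ)) ^ 2 * (8 / l1 ^ 2))
  refine ⟨Real.sqrt D, fun ψ => ?_⟩
  have hD : 0 ≤ D := by positivity
  set φ := W ψ - z • ψ
  set χ := coinMinus l2 (fun m : ℤ => freq (θ + m * Φ)) (fun m => ψ m) with hχ
  set U : ℤ → 𝕍 := fun m => !![χ m; z * ψ m 0] with hUdef
  set ε : ℤ → ℝ := fun m => 2 / l1 * (‖φ m 1‖ + ‖φ (m + 1) 0‖) with hε
  have hU0 : ∀ m, ‖χ m‖ ≤ ‖U m‖ := fun m => norm_col_apply_le (U m) 0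
  have hU1 : ∀ m, ‖ψ m 0‖ ≤ ‖U m‖ := fun m => by
    have : ‖z * ψ m 0‖ ≤ ‖U m‖ := norm_col_apply_le (U m) 1
    rwa [norm_mul, hz, one_mul] at this
  have hU2 : ∀ m, ‖ψ m 1‖ ≤ 2 / sq1 l2 * ‖U m‖ := fun m => by
    have e : (sq1 l2 : ℂ) * ψ m 1 = χ m + l2 * freq (θ + m * Φ) * ψ m 0 := by
      rw [hχ, coinMinus]; ring
    have e' := congrArg norm e
    rw [norm_mul, nb'] at e'
    rw [div_mul_eq_mul_div, le_div_iff₀ hb, mul_comm, e']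
    refine (norm_add_le _ _).trans ?_
    rw [norm_mul, norm_mul, hE, nb]
    nlinarith [hU0 m, hU1 m, norm_nonneg (ψ m 0), hl2.2]
  have hUle : ∀ m, ‖U m‖ ≤ 2 * (‖ψ m 0‖ + ‖ψ m 1‖) := fun m => by
    refine (norm_col_le (U m)).trans ?_
    change ‖χ m‖ + ‖z * ψ m 0‖ ≤ _
    have : ‖χ m‖ ≤ l2 * ‖ψ m 0‖ + sq1 l2 * ‖ψ m 1‖ := by
      rw [hχ, coinMinus]
      refine (norm_add_le _ _).trans (le_of_eq ?_)
      rw [norm_mul, norm_mul, norm_mul, norm_neg, hE, nb, nb', mul_one]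
    rw [norm_mul, hz]
    nlinarith [norm_nonneg (ψ m 0), norm_nonneg (ψ m 1), hl2.2, sq1_le_one l2]
  have hUs : Summable fun m => ‖U m‖ ^ 2 :=
    Summable.of_sq_le_sum (C := 2) (summable_norm_sq_apply_H2 ψ 0) (summable_norm_sq_apply_H2 ψ 1)
      fun m => by simpa using hUle m
  have hφ0 := (summable_norm_sq_apply_H2 φ 0).comp_add_int 1
  have hφ1 := summable_norm_sq_apply_H2 φ 1
  have hεle : ∀ m, ε m ^ 2 ≤ 8 / l1 ^ 2 * (‖φ (m + 1) 0‖ ^ 2 + ‖φ m 1‖ ^ 2) := fun m => by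
    have e : ε m ^ 2 = 8 / l1 ^ 2 * ((‖φ m 1‖ + ‖φ (m + 1) 0‖) ^ 2 / 2) := by
      rw [hε]; ring
    rw [e]
    refine mul_le_mul_of_nonneg_left ?_ (by positivity)
    nlinarith [sq_nonneg (‖φ m 1‖ - ‖φ (m + 1) 0‖)]
  have hεs : Summable fun m => ε m ^ 2 :=
    ((hφ0.add hφ1).mul_left _).of_nonneg_of_le (fun m => sq_nonneg _) hεle
  have hεt : ∑' m, ε m ^ 2 ≤ 8 / l1 ^ 2 * ‖φ‖ ^ 2 := by
    refine (hεs.tsum_le_tsum hεle ((hφ0.add hφ1).mul_left _)).trans (le_of_eq ?_)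
    rw [tsum_mul_left, hφ0.tsum_add hφ1, tsum_add_int (fun m => ‖φ m 0‖ ^ 2), norm_sq_H2_eq]
  have hUε : ∀ m : ℤ, ‖U (m + 1) - (szego l1 l2 z).eval (freq (θ + m * Φ)) * U m‖ ≤ ε m := by
    intro m
    have := hW.transfer hl1 hl2 hz0 ψ m
    rw [hUdef]
    dsimp only
    rw [this]
    refine (norm_col_le _).trans ?_
    change ‖φ m 1 / l1‖ + ‖-(sq1 l1 * φ m 1 / l1) - φ (m + 1) 0‖ ≤ 2 / l1 * _
    have h1 : ‖-(sq1 l1 * φ m 1 / l1) - φ (m + 1) 0‖ ≤ sq1 l1 * ‖φ m 1‖ / l1 + ‖φ (m + 1) 0‖ := by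
      refine (norm_sub_le _ _).trans (le_of_eq ?_)
      rw [norm_neg, norm_div, norm_mul, na, na']
    have h2 : sq1 l1 * ‖φ m 1‖ / l1 ≤ 1 * ‖φ m 1‖ / l1 := by
      gcongr
      exact sq1_le_one l1
    have h3 : ‖φ (m + 1) 0‖ ≤ 2 / l1 * ‖φ (m + 1) 0‖ := by
      refine le_mul_of_one_le_left (norm_nonneg _) ?_
      rw [le_div_iff₀ ha]; linarith [hl1.2]
    rw [norm_div, na]
    have h4 : 2 / l1 * (‖φ m 1‖ + ‖φ (m + 1) 0‖)
        = ‖φ m 1‖ / l1 + 1 * ‖φ m 1‖ / l1 + 2 / l1 * ‖φ (m + 1) 0‖ := by ring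
    linarith
  have hfin := tsum_sq_le_of_expands (u := fun m => ‖U m‖) (fun m => norm_nonneg _) hUs hεs
    (hC U (fun m => freq (θ + m * Φ)) ε hE hEs hUε)
  have hψ : ‖ψ‖ ^ 2 ≤ K * ∑' m, ‖U m‖ ^ 2 := by
    rw [← (hasSum_norm_sq_H2 ψ).tsum_eq, ← tsum_mul_left]
    refine (hasSum_norm_sq_H2 ψ).summable.tsum_le_tsum (fun m => ?_) (hUs.mul_left K)
    have h1 := pow_le_pow_left₀ (norm_nonneg _) (hU1 m) 2
    have h2 := pow_le_pow_left₀ (norm_nonneg _) (hU2 m) 2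
    rw [mul_pow] at h2
    linarith [add_mul 1 ((2 / sq1 l2) ^ 2) (‖U m‖ ^ 2)]
  refine le_of_sq_le_sq ?_ (by positivity)
  rw [mul_pow, Real.sq_sqrt hD]
  calc ‖ψ‖ ^ 2 ≤ K * ((C * (n + n : ℕ)) ^ 2 * (8 / l1 ^ 2 * ‖φ‖ ^ 2)) :=
        hψ.trans (by gcongr; exact hfin.trans (by gcongr))
    _ = _ := by ring

lemma rate_szego_le (hΦ : Irrational Φ) {W : H2 →L[ℂ] H2} (hW : IsWalk l1 l2 Φ θ W)
    (hl1 : 0 < l1 ∧ l1 < 1) (hl2 : 0 < l2 ∧ l2 < 1) (hz : z ∈ spectrum ℂ W) :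
    z ≠ 0 ∧ (szego l1 l2 z).rate (freq Φ) 0
      ≤ max (Real.log ((sq1 l1 * l2) / (l1 * sq1 l2))) 0 := by
  have hu : W ∈ unitary (H2 →L[ℂ] H2) :=
    mem_unitary_of_norm_map_of_surjective (hW.norm_map hl1 hl2) (hW.surjective hl1 hl2)
  have hz1 : ‖z‖ = 1 := spectrum.norm_eq_one_of_unitary hu hz
  have hz0 : z ≠ 0 := by rintro rfl; simp at hz1
  refine ⟨hz0, ?_⟩
  by_contra! hlt
  have hκ : 0 < (sq1 l1 * l2) / (l1 * sq1 l2) := by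
    have := sq1_pos hl1; have := sq1_pos hl2; have := hl1.1; have := hl2.1
    positivity
  have key : ∀ n : ℕ, ‖(-((sq1 l1 * l2) / (l1 * sq1 l2) : ℝ) : ℂ) ^ (n + 1)‖
      ≤ Real.exp ((n + 1 : ℕ) * Real.log ((sq1 l1 * l2) / (l1 * sq1 l2))) := by
    intro n
    rw [norm_pow, norm_neg, Complex.norm_real, Real.norm_of_nonneg hκ.le, Real.exp_nat_mul,
      Real.exp_log hκ]
  obtain ⟨n, hn⟩ := TrigCocycle.exists_expands hΦ (det_eval_szego hl1 hl2 hz0)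
    (l := Real.log ((sq1 l1 * l2) / (l1 * sq1 l2)))
    (fun n hn => by
      obtain ⟨n, rfl⟩ := Nat.exists_eq_succ_of_ne_zero hn.ne'
      rw [trace_szego_hi_pow]; exact key n)
    (fun n hn => by
      obtain ⟨n, rfl⟩ := Nat.exists_eq_succ_of_ne_zero hn.ne'
      rw [trace_szego_lo_pow]; exact key n) hlt
  obtain ⟨C, hC⟩ := hW.exists_norm_le hl1 hl2 hz1 hn
  exact not_norm_le_of_mem_spectrum hu hz C hC

end Spectrum

lemma continuous_freq : Continuous freq := by
  unfold freq
  fun_prop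

lemma circleMap_eq_freq (x : ℝ) : circleMap 0 1 (2 * Real.pi * x) = freq x := by
  simp [circleMap, freq]

namespace TrigCocycle
variable {A : TrigCocycle} {ω : ℂ}

lemma continuous_prod_freq (hω : ω ≠ 0) (n : ℕ) : Continuous fun x => A.prod ω n (freq x) := by
  simp only [A.prod_eq_sum hω n (freq_ne_zero _)]
  refine continuous_finsetSum _ fun k _ => ?_
  exact (continuous_freq.zpow₀ k fun x => Or.inl (freq_ne_zero x)).smul continuous_const

/-- Jensen's inequality for the lower right entry of the product. -/
lemma log_norm_hi_pow_le_integral (hω : ‖ω‖ = 1) (hA : ∀ ζ ≠ 0, (A.eval ζ).det = 1) (n : ℕ)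
    (hn : (A.hi ^ n) 1 1 ≠ 0) :
    Real.log ‖(A.hi ^ n) 1 1‖ ≤ ∫ x in (0 : ℝ)..1, Real.log ‖A.prod ω n (freq x)‖ := by
  have hω0 : ω ≠ 0 := by rintro rfl; simp at hω
  set p : Polynomial ℂ := ∑ j ∈ Finset.range (2 * n + 1),
    Polynomial.C (A.coeff ω n ((j : ℤ) - n) 1 1) * Polynomial.X ^ j with hp
  have hpe : ∀ ζ ≠ 0, p.eval ζ = ζ ^ n * A.prod ω n ζ 1 1 := by
    intro ζ hζ
    rw [A.prod_eq_sum hω0 n hζ, Matrix.sum_apply, Finset.mul_sum, hp, Polynomial.eval_finsetSum]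
    refine Finset.sum_nbij' (fun j : ℕ => (j : ℤ) - n) (fun k : ℤ => (k + n).toNat) ?_ ?_ ?_ ?_ ?_
    · intro j hj; simp only [Finset.mem_range, Finset.mem_Icc] at *; omega
    · intro j hj; simp only [Finset.mem_range, Finset.mem_Icc] at *; omega
    · intro j hj; simp
    · intro j hj; simp only [Finset.mem_Icc] at hj; omega
    · intro j hj
      rw [Polynomial.eval_mul, Polynomial.eval_C, Polynomial.eval_pow, Polynomial.eval_X,
        Matrix.smul_apply, smul_eq_mul, zpow_sub₀ hζ, zpow_natCast, zpow_natCast]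
      field_simp
  have hc : ‖p.coeff (2 * n)‖ = ‖(A.hi ^ n) 1 1‖ := by
    have : p.coeff (2 * n) = A.coeff ω n n 1 1 := by
      rw [hp, Polynomial.finsetSum_coeff]
      simp only [Polynomial.coeff_C_mul_X_pow]
      rw [Finset.sum_ite_eq, if_pos (by simp)]
      congr 2
      push_cast
      ring
    rw [this, A.coeff_self, Matrix.smul_apply, norm_smul, norm_prod]
    simp [hω]
  have hc0 : p.coeff (2 * n) ≠ 0 := by rwa [← norm_ne_zero_iff, hc, norm_ne_zero_iff]
  have hdeg : p.natDegree = 2 * n := by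
    refine le_antisymm ?_ (Polynomial.le_natDegree_of_ne_zero hc0)
    refine Polynomial.natDegree_sum_le_of_forall_le _ _ fun j hj => ?_
    refine (Polynomial.natDegree_C_mul_X_pow_le _ _).trans ?_
    simp only [Finset.mem_range] at hj
    omega
  have hlead : ‖p.leadingCoeff‖ = ‖(A.hi ^ n) 1 1‖ := by
    rw [Polynomial.leadingCoeff, hdeg, hc]
  have h1 : ∀ x, Real.log ‖p.eval (freq x)‖ ≤ Real.log ‖A.prod ω n (freq x)‖ := by
    intro x
    have hM := one_le_norm_of_det (A.det_prod hω0 hA n (freq_ne_zero x))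
    rw [hpe _ (freq_ne_zero x), norm_mul, norm_pow, norm_freq, one_pow, one_mul]
    rcases eq_or_ne (A.prod ω n (freq x) 1 1) 0 with h | h
    · rw [h, norm_zero, Real.log_zero]; exact Real.log_nonneg hM
    · exact Real.log_le_log (norm_pos_iff.2 h) (norm_entry_le _ 1 1)
  have h2π : (2 * Real.pi) ≠ 0 := by positivity
  have hI : IntervalIntegrable (fun x => Real.log ‖p.eval (freq x)‖) volume 0 1 := by
    have := (p.intervalIntegrable_mahlerMeasure).comp_mul_left (c := 2 * Real.pi)
    rw [zero_div, div_self h2π] at this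
    simpa only [circleMap_eq_freq] using this
  have hIeq : ∫ x in (0 : ℝ)..1, Real.log ‖p.eval (freq x)‖ = Real.log p.mahlerMeasure := by
    have := intervalIntegral.integral_comp_mul_left (a := 0) (b := 1)
      (fun x => Real.log ‖p.eval (circleMap 0 1 x)‖) h2π
    simp only [circleMap_eq_freq, mul_zero, mul_one] at this
    rw [this, ← p.logMahlerMeasure_eq_log_MahlerMeasure, Polynomial.logMahlerMeasure_def,
      Real.circleAverage_def]
  calc Real.log ‖(A.hi ^ n) 1 1‖ ≤ Real.log p.mahlerMeasure := by
        rw [← hlead]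
        refine Real.log_le_log ?_ p.leadingCoeff_le_mahlerMeasure
        rw [hlead]; exact norm_pos_iff.2 hn
    _ ≤ _ := by
        rw [← hIeq]
        refine intervalIntegral.integral_mono_on zero_le_one hI ?_ fun x _ => h1 x
        refine Continuous.intervalIntegrable ?_ _ _
        refine (continuous_prod_freq hω0 n).norm.log fun x => ?_
        exact (zero_lt_one.trans_le
          (one_le_norm_of_det (A.det_prod hω0 hA n (freq_ne_zero x)))).ne'

lemma integral_log_norm_prod_le (hω : ‖ω‖ = 1) (hA : ∀ ζ ≠ 0, (A.eval ζ).det = 1) (n : ℕ) :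
    ∫ x in (0 : ℝ)..1, Real.log ‖A.prod ω n (freq x)‖ ≤ Real.log (A.growth ω n 0) := by
  have hω0 : ω ≠ 0 := by rintro rfl; simp at hω
  have hpos : ∀ x, 0 < ‖A.prod ω n (freq x)‖ := fun x =>
    zero_lt_one.trans_le (one_le_norm_of_det (A.det_prod hω0 hA n (freq_ne_zero x)))
  have := intervalIntegral.integral_mono_on (μ := volume) (a := 0) (b := 1) zero_le_one
    (((continuous_prod_freq (A := A) hω0 n).norm.log
      fun x => (hpos x).ne').intervalIntegrable _ _)
    (continuous_const (y := Real.log (A.growth ω n 0)).intervalIntegrable _ _)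
    fun x _ => Real.log_le_log (hpos x)
      (norm_prod_le_growth hω n (by rw [norm_freq, Real.exp_zero]))
  simpa using this

end TrigCocycle

lemma coc_SzP_zero {l1 l2 : ℝ} (hl2 : 0 < l2 ∧ l2 < 1) {z : ℂ} (hz : z ≠ 0) (Φ : ℝ) (n : ℕ)
    (x : ℝ) : coc Φ (SzP 0 l1 l2 z) n x = (szego l1 l2 z).prod (freq Φ) n (freq x) := by
  induction n with
  | zero => rfl
  | succ n ih => rw [coc, ih, SzP_zero hl2 hz, TrigCocycle.prod, add_comm, freq_add, freq_pow]

/-- Lyapunov exponent at `t = 0`: for `z` in the spectrum of the walk operator,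
`L(Φ, S_z⁺) = max{ ln((λ₁′λ₂)/(λ₁λ₂′)), 0 }`. -/
theorem lyapunov_t_zero
    (l1 l2 Φ θ : ℝ) (z : ℂ)
    (hl1 : l1 ∈ Set.Ioo (0 : ℝ) 1)
    (hl2 : l2 ∈ Set.Ioo (0 : ℝ) 1)
    (hΦ : Irrational Φ)
    (W : H2 →L[ℂ] H2)
    (hW : ∀ (ψ : H2) (n : ℤ),
      W ψ n 0 = wPlus 0 l1 l2 Φ θ (fun m => ψ m) n ∧
      W ψ n 1 = wMinus 0 l1 l2 Φ θ (fun m => ψ m) n)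
    (hz : z ∈ spectrum ℂ W) :
    HasLyap Φ (SzP 0 l1 l2 z)
      (max (Real.log ((sq1 l1 * l2) / (l1 * sq1 l2))) 0) := by
  have hwalk : IsWalk l1 l2 Φ θ W := fun ψ n => by
    rw [← wPlus_zero, ← wMinus_zero]; exact hW ψ n
  obtain ⟨hz0, hrate⟩ := rate_szego_le hΦ hwalk hl1 hl2 hz
  have hdet := det_eval_szego hl1 hl2 hz0
  have hlim := TrigCocycle.tendsto_rate (norm_freq Φ) hdet 0
  set κ := (sq1 l1 * l2) / (l1 * sq1 l2) with hκdef
  have hκ : 0 < κ := by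
    have := sq1_pos hl1; have := sq1_pos hl2; have := hl1.1; have := hl2.1
    positivity
  set I : ℕ → ℝ := fun n =>
    ∫ x in (0 : ℝ)..1, Real.log ‖(szego l1 l2 z).prod (freq Φ) n (freq x)‖
  have hlow : ∀ n : ℕ, 0 < n → max (Real.log κ) 0 ≤ I n / n := by
    intro n hn
    refine max_le ?_ (div_nonneg ?_ n.cast_nonneg)
    · obtain ⟨m, rfl⟩ := Nat.exists_eq_succ_of_ne_zero hn.ne'
      have e : ‖((szego l1 l2 z).hi ^ (m + 1)) 1 1‖ = κ ^ (m + 1) := by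
        rw [szego_hi_pow_one_one, norm_pow, norm_neg, Complex.norm_real,
          Real.norm_of_nonneg hκ.le]
      have := TrigCocycle.log_norm_hi_pow_le_integral (norm_freq Φ) hdet (m + 1)
        (norm_pos_iff.1 (by rw [e]; positivity))
      rw [e, Real.log_pow] at this
      rwa [le_div_iff₀ (by positivity), mul_comm]
    · exact intervalIntegral.integral_nonneg zero_le_one fun x _ => Real.log_nonneg
        (one_le_norm_of_det (TrigCocycle.det_prod _ (freq_ne_zero Φ) hdet n (freq_ne_zero x)))
  have hup : ∀ n : ℕ, I n / n ≤ Real.log ((szego l1 l2 z).growth (freq Φ) n 0) / n := fun n => by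
    gcongr
    exact TrigCocycle.integral_log_norm_prod_le (norm_freq Φ) hdet n
  have heq : (szego l1 l2 z).rate (freq Φ) 0 = max (Real.log κ) 0 := by
    refine le_antisymm hrate (ge_of_tendsto hlim ?_)
    filter_upwards [Filter.eventually_gt_atTop 0] with n hn using (hlow n hn).trans (hup n)
  rw [heq] at hlim
  simp only [HasLyap, coc_SzP_zero hl2 hz0, one_div_mul_eq_div]
  refine tendsto_of_tendsto_of_tendsto_of_le_of_le' tendsto_const_nhds hlim ?_
    (Filter.Eventually.of_forall hup)
  filter_upwards [Filter.eventually_gt_atTop 0] with n hn using hlow n hn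


end
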